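/- Let K be a connected compact subset of Ω∖Z and let u_ε be a sequence of solutions of (E_ε) such that lim_{ε→0} (inf_K |u_ε|) = 0. Then ‖u_ε‖_{L^∞(K)} → 0 as ε → 0. -/

import Mathlib

open MeasureTheory Real Filter Set Metric Topology

noncomputable section

/-- The Euclidean plane `ℝ²`. -/
abbrev Pl := EuclideanSpace ℝ (Fin 2)

/-- The unit lattice `ℤ² ⊆ ℝ²`; the flat 2-torus `Ω` is its quotient, which we model by
working with doubly periodic functions on the plane. -/
def unitLattice : Set Pl :=
  {v | ∃ a b : ℤ, v = (a : ℝ) • EuclideanSpace.single 0 (1:ℝ) +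
      (b : ℝ) • EuclideanSpace.single 1 (1:ℝ)}

/-- A fundamental domain for the torus `Ω` (of total area `|Ω| = 1`). -/
def fund : Set Pl := {x | x 0 ∈ Ico (0:ℝ) 1 ∧ x 1 ∈ Ico (0:ℝ) 1}

/-- A doubly periodic function on the plane, i.e. a function on the torus `Ω`. -/
def Periodic2 (u : Pl → ℝ) : Prop := ∀ x : Pl, ∀ v ∈ unitLattice, u (x + v) = u x

/-- Partial derivative in the `i`-th coordinate direction. -/
def pd (u : Pl → ℝ) (i : Fin 2) : Pl → ℝ :=
  fun x => lineDeriv ℝ u x (EuclideanSpace.single i (1:ℝ))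

/-- The Laplacian `Δu`. -/
def lap (u : Pl → ℝ) (x : Pl) : ℝ := pd (pd u 0) 0 x + pd (pd u 1) 1 x

/-- `|∇u|²`. -/
def gradSq (u : Pl → ℝ) (x : Pl) : ℝ := (pd u 0 x) ^ 2 + (pd u 1 x) ^ 2

/-- The nonlinearity `f_τ(t) = e^t (1 − e^t) / (τ + e^t)³`. -/
def fτ (τ t : ℝ) : ℝ := exp t * (1 - exp t) / (τ + exp t) ^ 3

/-- `f_τ'(t) = e^t (τ − 2(τ+1) e^t + e^{2t}) / (τ + e^t)⁴`. -/
def fτ' (τ t : ℝ) : ℝ := exp t * (τ - 2 * (τ + 1) * exp t + exp (2 * t)) / (τ + exp t) ^ 4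

/-- The antiderivative `F_{2,τ}(t) = e^t ((1−τ) e^t + 2τ) / (2τ² (τ+e^t)²)` of `f_τ`. -/
def F2τ (τ t : ℝ) : ℝ := exp t * ((1 - τ) * exp t + 2 * τ) / (2 * τ ^ 2 * (τ + exp t) ^ 2)

/-- `u − 2a ln‖· − p‖` extends smoothly across `p`: this encodes the distributional
equation `Δu = 4πa δ_p + (smooth)` near `p`. -/
def LogSing (u : Pl → ℝ) (p : Pl) (a : ℝ) : Prop :=
  ∃ r > 0, ∃ v : Pl → ℝ, ContDiffOn ℝ (⊤ : ℕ∞) v (ball p r) ∧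
    ∀ x ∈ ball p r, x ≠ p → u x = 2 * a * Real.log ‖x - p‖ + v x

/-- The vortex data: distinct points `p_{j,1}` (`1 ≤ j ≤ d₁`), `p_{j,2}` (`1 ≤ j ≤ d₂`)
of the torus with multiplicities `m_{j,1} ≥ 0`, `m_{j,2} ≥ 0`. -/
structure VortexData where
  d₁ : ℕ
  d₂ : ℕ
  p₁ : Fin d₁ → Pl
  p₂ : Fin d₂ → Pl
  m₁ : Fin d₁ → ℝ
  m₂ : Fin d₂ → ℝ
  m₁_nonneg : ∀ j, 0 ≤ m₁ j
  m₂_nonneg : ∀ j, 0 ≤ m₂ j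
  distinct : ∀ i j : Fin d₁ ⊕ Fin d₂, i ≠ j → ∀ v ∈ unitLattice,
      Sum.elim p₁ p₂ i ≠ Sum.elim p₁ p₂ j + v

namespace VortexData
variable (V : VortexData)

/-- The set `Z₁` of vortex points `p_{j,1}` (viewed in the plane: all lattice translates). -/
def Z1 : Set Pl := {x | ∃ j v, v ∈ unitLattice ∧ x = V.p₁ j + v}

/-- The set `Z₂` of vortex points `p_{j,2}` (viewed in the plane: all lattice translates). -/
def Z2 : Set Pl := {x | ∃ j v, v ∈ unitLattice ∧ x = V.p₂ j + v}

/-- The full vortex set `Z = Z₁ ∪ Z₂`. -/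
def Z : Set Pl := V.Z1 ∪ V.Z2

/-- `N₁ = Σ_j m_{j,1}`. -/
def N1 : ℝ := ∑ j, V.m₁ j

/-- `N₂ = Σ_j m_{j,2}`. -/
def N2 : ℝ := ∑ j, V.m₂ j

end VortexData

/-- `u` is a solution of `(E_ε)`:
`Δu + ε⁻² f_τ(u) = 4π Σ_j m_{j,1} δ_{p_{j,1}} − 4π Σ_j m_{j,2} δ_{p_{j,2}}` on `Ω`,
formulated classically: `u` is doubly periodic, smooth away from `Z`, solves the PDE
classically off `Z`, and has the prescribed logarithmic singularities at the vortices. -/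
structure IsSolution (V : VortexData) (τ ε : ℝ) (u : Pl → ℝ) : Prop where
  periodic : Periodic2 u
  smooth : ContDiffOn ℝ (⊤ : ℕ∞) u (V.Z)ᶜ
  pde : ∀ x ∉ V.Z, lap u x + (ε ^ 2)⁻¹ * fτ τ (u x) = 0
  sing₁ : ∀ j, LogSing u (V.p₁ j) (V.m₁ j)
  sing₂ : ∀ j, LogSing u (V.p₂ j) (-(V.m₂ j))

/-- The quadratic form `∫_Ω |∇φ|² − ε⁻² f_τ'(u) φ²` of the linearized operator at `u`. -/
def QuadForm (τ ε : ℝ) (u φ : Pl → ℝ) : ℝ :=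
  ∫ x in fund, (gradSq φ x - (ε ^ 2)⁻¹ * fτ' τ (u x) * (φ x) ^ 2)

/-- `u` is a stable solution: the first eigenvalue `μ_ε` of the linearized operator is
nonnegative, i.e. the quadratic form is nonnegative on all (smooth, doubly periodic)
test functions. -/
def Stable (τ ε : ℝ) (u : Pl → ℝ) : Prop :=
  ∀ φ : Pl → ℝ, ContDiff ℝ (⊤ : ℕ∞) φ → Periodic2 φ → 0 ≤ QuadForm τ ε u φ

/-- `u` is strictly stable: the first eigenvalue `μ_ε` of the linearized operator is
strictly positive. -/
def StrictlyStable (τ ε : ℝ) (u : Pl → ℝ) : Prop :=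
  ∃ μ > 0, ∀ φ : Pl → ℝ, ContDiff ℝ (⊤ : ℕ∞) φ → Periodic2 φ →
    μ * (∫ x in fund, (φ x) ^ 2) ≤ QuadForm τ ε u φ

lemma second_deriv_nonpos_of_isLocalMax {g : ℝ → ℝ} (hc : ContinuousAt g 0) (hm : IsLocalMax g 0) :
    deriv (deriv g) 0 ≤ 0 := by
  by_contra h
  push Not at h
  have hmin := isLocalMin_of_deriv_deriv_pos h hm.deriv_eq_zero hc
  have heq : g =ᶠ[𝓝 0] fun _ => g 0 := by
    filter_upwards [hm, hmin] with t h1 h2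
    exact le_antisymm h1 h2
  have h2 : deriv (deriv g) 0 = 0 := by
    have := heq.deriv.deriv_eq
    rw [this]
    simp
  linarith

lemma deriv_line (φ : Pl → ℝ) (i : Fin 2) (x : Pl) :
    deriv (fun t : ℝ => φ (x + t • EuclideanSpace.single i (1:ℝ))) =
      fun t => pd φ i (x + t • EuclideanSpace.single i (1:ℝ)) := by
  funext t
  unfold pd lineDeriv
  have := deriv_comp_const_add (fun t : ℝ => φ (x + t • EuclideanSpace.single i (1:ℝ))) t 0
  simp only [add_zero] at this
  rw [← this]
  congr 1
  funext s
  rw [add_smul, add_assoc]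

lemma pd_pd_nonpos {φ : Pl → ℝ} {x : Pl} (i : Fin 2) (hc : ContinuousAt φ x)
    (hm : IsLocalMax φ x) : pd (pd φ i) i x ≤ 0 := by
  have hcl : ContinuousAt (fun t : ℝ => x + t • EuclideanSpace.single i (1:ℝ)) 0 := by fun_prop
  have hx : x = x + (0:ℝ) • EuclideanSpace.single i (1:ℝ) := by simp
  have h1 : ContinuousAt (fun t : ℝ => φ (x + t • EuclideanSpace.single i (1:ℝ))) 0 := by
    refine ContinuousAt.comp (g := φ) ?_ hcl
    rw [← hx]; exact hc
  have h2 : IsLocalMax (fun t : ℝ => φ (x + t • EuclideanSpace.single i (1:ℝ))) 0 := by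
    have ht : Tendsto (fun t : ℝ => x + t • EuclideanSpace.single i (1:ℝ)) (𝓝 0) (𝓝 x) := by
      have := hcl.tendsto
      simpa using this
    have := ht.eventually hm
    refine this.mono fun t ht => ?_
    simpa using ht
  have := second_deriv_nonpos_of_isLocalMax h1 h2
  rw [deriv_line] at this
  exact this

lemma lap_nonpos {φ : Pl → ℝ} {x : Pl} (hc : ContinuousAt φ x)
    (hm : IsLocalMax φ x) : lap φ x ≤ 0 := by
  unfold lap
  have := pd_pd_nonpos 0 hc hm
  have := pd_pd_nonpos 1 hc hm
  linarith

lemma pd_eq_fderiv {u : Pl → ℝ} {x : Pl} (hd : DifferentiableAt ℝ u x) (i : Fin 2) :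
    pd u i x = fderiv ℝ u x (EuclideanSpace.single i (1:ℝ)) := hd.lineDeriv_eq_fderiv

lemma diffAt_of {u : Pl → ℝ} {O : Set Pl} (hO : IsOpen O)
    (hu : ContDiffOn ℝ (⊤ : ℕ∞) u O) {x : Pl} (hx : x ∈ O) : DifferentiableAt ℝ u x :=
  (hu.differentiableOn (by simp)).differentiableAt (hO.mem_nhds hx)

lemma pd_contDiffOn {u : Pl → ℝ} {O : Set Pl} (hO : IsOpen O)
    (hu : ContDiffOn ℝ (⊤ : ℕ∞) u O) (i : Fin 2) : ContDiffOn ℝ (⊤ : ℕ∞) (pd u i) O := by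
  have h1 : ContDiffOn ℝ (⊤ : ℕ∞) (fun x => fderiv ℝ u x (EuclideanSpace.single i (1:ℝ))) O :=
    (hu.fderiv_of_isOpen hO (by simp)).clm_apply contDiffOn_const
  exact h1.congr fun x hx => pd_eq_fderiv (diffAt_of hO hu hx) i

lemma pd_lin {u φ : Pl → ℝ} {x : Pl} (c : ℝ) (hu : DifferentiableAt ℝ u x)
    (hφ : DifferentiableAt ℝ φ x) (i : Fin 2) :
    pd (fun y => c * u y + φ y) i x = c * pd u i x + pd φ i x := by
  rw [pd_eq_fderiv (by fun_prop), pd_eq_fderiv hu, pd_eq_fderiv hφ]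
  have : HasFDerivAt (fun y => c * u y + φ y) (c • fderiv ℝ u x + fderiv ℝ φ x) x :=
    (hu.hasFDerivAt.const_mul c).add hφ.hasFDerivAt
  rw [this.fderiv]; simp

lemma pd_congr {u v : Pl → ℝ} {x : Pl} (h : u =ᶠ[𝓝 x] v) (i : Fin 2) : pd u i x = pd v i x :=
  h.lineDeriv_eq

lemma lap_lin {u φ : Pl → ℝ} {O : Set Pl} (hO : IsOpen O) (hu : ContDiffOn ℝ (⊤ : ℕ∞) u O)
    (hφ : ContDiffOn ℝ (⊤ : ℕ∞) φ O) (c : ℝ) {x : Pl} (hx : x ∈ O) :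
    lap (fun y => c * u y + φ y) x = c * lap u x + lap φ x := by
  have key : ∀ i : Fin 2, pd (pd (fun y => c * u y + φ y) i) i x
      = c * pd (pd u i) i x + pd (pd φ i) i x := by
    intro i
    have : pd (fun y => c * u y + φ y) i =ᶠ[𝓝 x] fun y => c * pd u i y + pd φ i y := by
      filter_upwards [hO.mem_nhds hx] with y hy
      exact pd_lin c (diffAt_of hO hu hy) (diffAt_of hO hφ hy) i
    rw [pd_congr this]
    exact pd_lin c (diffAt_of hO (pd_contDiffOn hO hu i) hx) (diffAt_of hO (pd_contDiffOn hO hφ i) hx) i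
  unfold lap
  rw [key, key]; ring

lemma pd_of_hasDerivAt {φ : Pl → ℝ} {x : Pl} {i : Fin 2} {d : ℝ}
    (h : HasDerivAt (fun t : ℝ => φ (x + t • EuclideanSpace.single i (1:ℝ))) d 0) :
    pd φ i x = d := h.deriv

lemma lap_quad (c : ℝ) (z x : Pl) :
    lap (fun y => c * ((y 0 - z 0) ^ 2 + (y 1 - z 1) ^ 2)) x = 4 * c := by
  have h0 : pd (fun y => c * ((y 0 - z 0) ^ 2 + (y 1 - z 1) ^ 2)) 0 = fun y => c * (2 * (y 0 - z 0)) := by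
    funext y
    apply pd_of_hasDerivAt
    have : HasDerivAt (fun t : ℝ => c * ((y 0 + t - z 0) ^ 2 + (y 1 - z 1) ^ 2))
        (c * (2 * (y 0 - z 0))) 0 := by
      have := ((((hasDerivAt_id (0:ℝ)).const_add (y 0)).sub_const (z 0)).pow 2).add_const ((y 1 - z 1) ^ 2) |>.const_mul c
      refine HasDerivAt.congr_deriv this ?_
      simp
    simpa using this
  have h1 : pd (fun y => c * ((y 0 - z 0) ^ 2 + (y 1 - z 1) ^ 2)) 1 = fun y => c * (2 * (y 1 - z 1)) := by
    funext y
    apply pd_of_hasDerivAt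
    have : HasDerivAt (fun t : ℝ => c * ((y 0 - z 0) ^ 2 + (y 1 + t - z 1) ^ 2))
        (c * (2 * (y 1 - z 1))) 0 := by
      have := ((((hasDerivAt_id (0:ℝ)).const_add (y 1)).sub_const (z 1)).pow 2).const_add ((y 0 - z 0) ^ 2) |>.const_mul c
      refine HasDerivAt.congr_deriv this ?_
      simp
    simpa using this
  have g0 : pd (fun y => c * (2 * (y 0 - z 0))) 0 x = 2 * c := by
    apply pd_of_hasDerivAt
    have : HasDerivAt (fun t : ℝ => c * (2 * (x 0 + t - z 0))) (2 * c) 0 := by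
      have := (((((hasDerivAt_id (0:ℝ)).const_add (x 0)).sub_const (z 0)).const_mul 2)).const_mul c
      refine HasDerivAt.congr_deriv this ?_
      ring
    simpa using this
  have g1 : pd (fun y => c * (2 * (y 1 - z 1))) 1 x = 2 * c := by
    apply pd_of_hasDerivAt
    have : HasDerivAt (fun t : ℝ => c * (2 * (x 1 + t - z 1))) (2 * c) 0 := by
      have := (((((hasDerivAt_id (0:ℝ)).const_add (x 1)).sub_const (z 1)).const_mul 2)).const_mul c
      refine HasDerivAt.congr_deriv this ?_
      ring
    simpa using this
  unfold lap
  rw [h0, h1, g0, g1]; ring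

lemma lap_exp (B b d : ℝ) (x : Pl) :
    lap (fun y => B * Real.exp (b * (y 0 - d))) x = b ^ 2 * (B * Real.exp (b * (x 0 - d))) := by
  have hd : ∀ (C : ℝ) (y : Pl), HasDerivAt (fun t : ℝ => C * Real.exp (b * (y 0 + t - d)))
      (C * (b * Real.exp (b * (y 0 - d)))) 0 := by
    intro C y
    have := ((((hasDerivAt_id (0:ℝ)).const_add (y 0)).sub_const d).const_mul b).exp.const_mul C
    refine HasDerivAt.congr_deriv this ?_
    simp only [id, add_zero]; ring
  have h0 : ∀ C : ℝ, pd (fun y => C * Real.exp (b * (y 0 - d))) 0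
      = fun y => (C * b) * Real.exp (b * (y 0 - d)) := by
    intro C
    funext y
    apply pd_of_hasDerivAt
    have := hd C y
    rw [← mul_assoc] at this
    simpa using this
  have h1 : pd (fun y => B * Real.exp (b * (y 0 - d))) 1 = fun y => 0 := by
    funext y
    apply pd_of_hasDerivAt
    simpa using hasDerivAt_const (0:ℝ) _
  have h2 : pd (fun _ : Pl => (0:ℝ)) 1 x = 0 := by
    apply pd_of_hasDerivAt
    simpa using hasDerivAt_const (0:ℝ) _
  unfold lap
  rw [h0, h0, h1, h2]; ring

/-! ### The nonlinearity -/

lemma ftau_pos {τ t : ℝ} (hτ : 0 < τ) (ht : t < 0) : 0 < fτ τ t := by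
  unfold fτ
  have := Real.exp_pos t
  have : Real.exp t < 1 := by simpa using ht
  have : 0 < 1 - Real.exp t := by linarith
  positivity

lemma ftau_neg {τ t : ℝ} (hτ : 0 < τ) (ht : 0 < t) : fτ τ t < 0 := by
  unfold fτ
  have h1 := Real.exp_pos t
  have : 1 < Real.exp t := by simpa using ht
  have h2 : 1 - Real.exp t < 0 := by linarith
  exact div_neg_of_neg_of_pos (mul_neg_of_pos_of_neg h1 h2) (by positivity)

lemma ftau_upper {τ t : ℝ} (hτ : 0 < τ) : |fτ τ t| ≤ (1 + (τ ^ 2)⁻¹) * |t| := by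
  unfold fτ
  have h1 := Real.exp_pos t
  rw [abs_div, abs_mul, abs_of_pos h1, abs_of_pos (show 0 < (τ + rexp t) ^ 3 by positivity),
    div_le_iff₀ (by positivity)]
  rcases le_or_gt t 0 with ht | ht
  · have h2 : Real.exp t ≤ 1 := by simpa using ht
    have h3 := Real.add_one_le_exp t
    rw [abs_of_nonneg (by linarith), abs_of_nonpos ht]
    have : τ ^ 2 * rexp t ≤ (τ + rexp t) ^ 3 := by
      have : (τ + rexp t) ^ 3 = τ ^ 2 * rexp t + (τ^3 + 2 * τ^2 * rexp t + 3 * τ * rexp t ^ 2 + rexp t ^ 3) := by ring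
      rw [this]
      have : 0 ≤ τ^3 + 2 * τ^2 * rexp t + 3 * τ * rexp t ^ 2 + rexp t ^ 3 := by positivity
      linarith
    have h4 : rexp t ≤ (τ^2)⁻¹ * (τ + rexp t) ^ 3 := by
      rw [inv_mul_eq_div, le_div_iff₀ (by positivity)]; linarith
    have h5 : 0 ≤ (τ + rexp t) ^ 3 := by positivity
    calc rexp t * (1 - rexp t) ≤ ((τ^2)⁻¹ * (τ + rexp t) ^ 3) * (-t) := by
          apply mul_le_mul h4 (by linarith) (by linarith) (by positivity)
      _ ≤ _ := by nlinarith [mul_nonneg h5 (neg_nonneg.2 ht)]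
  · have h2 : 1 < Real.exp t := by simpa using ht
    have h3 := Real.add_one_le_exp (-t)
    have h6 : rexp t * rexp (-t) = 1 := by rw [← Real.exp_add]; simp
    rw [abs_of_nonpos (by linarith), abs_of_pos ht]
    have h7 : -(1 - rexp t) ≤ t * rexp t := by nlinarith
    have h8 : rexp t ^ 2 ≤ (τ + rexp t) ^ 3 := by
      calc rexp t ^ 2 ≤ rexp t ^ 3 := pow_le_pow_right₀ h2.le (by norm_num)
        _ ≤ _ := by gcongr; linarith
    have h9 : 0 ≤ (τ^2)⁻¹ * t * (τ + rexp t) ^ 3 := by positivity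
    calc rexp t * -(1 - rexp t) ≤ rexp t * (t * rexp t) := by gcongr
      _ = t * rexp t ^ 2 := by ring
      _ ≤ t * (τ + rexp t) ^ 3 := by gcongr
      _ ≤ _ := by nlinarith

lemma ftau_lower {τ : ℝ} (hτ : 0 < τ) : ∃ α > 0, ∀ t : ℝ, |t| ≤ 1 → α * |t| ≤ |fτ τ t| := by
  refine ⟨(rexp (-1) * rexp (-1)) / (τ + rexp 1) ^ 3, by positivity, fun t ht => ?_⟩
  obtain ⟨ht1, ht2⟩ := abs_le.1 ht
  unfold fτ
  have h1 := Real.exp_pos t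
  have h2 : rexp (-1) ≤ rexp t := Real.exp_le_exp.2 ht1
  have h3 : rexp t ≤ rexp 1 := Real.exp_le_exp.2 ht2
  have he : rexp (-1) ≤ 1 := by simp
  rw [abs_div, abs_mul, abs_of_pos h1, abs_of_pos (show 0 < (τ + rexp t) ^ 3 by positivity),
    div_mul_eq_mul_div]
  have h4 : rexp (-1) * |t| ≤ |1 - rexp t| := by
    rcases le_or_gt t 0 with h | h
    · rw [abs_of_nonpos h, abs_of_nonneg (by simpa using h)]
      have h3 := Real.add_one_le_exp (-t)
      have h6 : rexp t * rexp (-t) = 1 := by rw [← Real.exp_add]; simp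
      nlinarith
    · rw [abs_of_pos h, abs_of_nonpos (by simpa using h.le)]
      have h3 := Real.add_one_le_exp t
      nlinarith
  apply div_le_div₀ (by positivity) _ (by positivity) (by gcongr)
  calc rexp (-1) * rexp (-1) * |t| = rexp (-1) * (rexp (-1) * |t|) := by ring
    _ ≤ _ := by gcongr

lemma ftau_cont {τ : ℝ} (hτ : 0 < τ) : Continuous (fτ τ) := by
  unfold fτ
  refine Continuous.div (by fun_prop) (by fun_prop) fun t => ?_
  have := Real.exp_pos t
  positivity

/-- A classical solution on an open set `O`. -/
structure LocSol (τ ε : ℝ) (u : Pl → ℝ) (O : Set Pl) : Prop where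
  τpos : 0 < τ
  εpos : 0 < ε
  isOpen : IsOpen O
  smooth : ContDiffOn ℝ (⊤ : ℕ∞) u O
  pde : ∀ x ∈ O, lap u x + (ε ^ 2)⁻¹ * fτ τ (u x) = 0

namespace LocSol
variable {τ ε : ℝ} {u : Pl → ℝ} {O : Set Pl}

lemma contAt (H : LocSol τ ε u O) {x : Pl} (hx : x ∈ O) : ContinuousAt u x :=
  H.smooth.continuousOn.continuousAt (H.isOpen.mem_nhds hx)

/-- no positive local max -/
lemma not_localMax (H : LocSol τ ε u O) {x : Pl} (hx : x ∈ O) (hp : 0 < u x) :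
    ¬ IsLocalMax u x := by
  intro hm
  have h1 := lap_nonpos (H.contAt hx) hm
  have h2 := H.pde x hx
  have h3 := ftau_neg H.τpos hp
  have := H.εpos
  have h4 : 0 < (ε ^ 2)⁻¹ := by positivity
  nlinarith

lemma lap_affine (H : LocSol τ ε u O) {x : Pl} (hx : x ∈ O) (σ : ℝ) {φ : Pl → ℝ}
    (hφ : ContDiff ℝ (⊤ : ℕ∞) φ) :
    lap (fun y => σ * u y + φ y) x = - σ * ((ε ^ 2)⁻¹ * fτ τ (u x)) + lap φ x := by
  rw [lap_lin H.isOpen H.smooth hφ.contDiffOn σ hx]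
  have := H.pde x hx
  have : lap u x = - ((ε ^ 2)⁻¹ * fτ τ (u x)) := by linarith
  rw [this]; ring

/-- no negative local min -/
lemma not_localMin (H : LocSol τ ε u O) {x : Pl} (hx : x ∈ O) (hp : u x < 0) :
    ¬ IsLocalMin u x := by
  intro hm
  have hm' : IsLocalMax (fun y => (-1:ℝ) * u y + 0) x := by
    have := hm.neg
    simpa using this
  have hc : ContinuousAt (fun y => (-1:ℝ) * u y + 0) x := by
    have := H.contAt hx
    fun_prop
  have h1 := lap_nonpos hc hm'
  rw [H.lap_affine hx (-1) (φ := fun _ => 0) contDiff_const] at h1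
  have h5 : lap (fun _ => (0:ℝ)) x = 0 := by
    have := lap_quad 0 0 x
    simpa using this
  have h3 := ftau_pos H.τpos hp
  have := H.εpos
  have h4 : 0 < (ε ^ 2)⁻¹ := by positivity
  have := mul_pos h4 h3
  linarith

/-- Maximum principle for `|u|` on discs. -/
lemma maxPrinciple (H : LocSol τ ε u O) {c x : Pl} {s δ : ℝ} (hD : closedBall c s ⊆ O)
    (hδ : 0 < δ) (hx : x ∈ closedBall c s) (hux : δ ≤ |u x|) :
    ∃ y ∈ sphere c s, δ ≤ |u y| := by
  have hcont : ContinuousOn (fun y => |u y|) (closedBall c s) :=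
    (H.smooth.continuousOn.mono hD).abs
  obtain ⟨y, hy, hmax⟩ := (isCompact_closedBall c s).exists_isMaxOn ⟨x, hx⟩ hcont
  have hyδ : δ ≤ |u y| := hux.trans (hmax hx)
  by_cases hys : y ∈ sphere c s
  · exact ⟨y, hys, hyδ⟩
  exfalso
  have hyb : y ∈ ball c s := by
    rw [mem_ball]
    exact lt_of_le_of_ne hy hys
  have hnb : ∀ᶠ z in 𝓝 y, |u z| ≤ |u y| := by
    filter_upwards [isOpen_ball.mem_nhds hyb] with z hz
    exact hmax (ball_subset_closedBall hz)
  rcases lt_trichotomy (u y) 0 with h | h | h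
  · apply H.not_localMin (hD hy) h
    filter_upwards [hnb] with z hz
    rw [abs_of_neg h] at hz
    have := neg_abs_le (u z)
    linarith
  · rw [h] at hyδ; simp at hyδ; linarith
  · apply H.not_localMax (hD hy) h
    filter_upwards [hnb] with z hz
    rw [abs_of_pos h] at hz
    exact (le_abs_self _).trans hz

lemma normsq (y z : Pl) : (y 0 - z 0) ^ 2 + (y 1 - z 1) ^ 2 = dist y z ^ 2 := by
  rw [EuclideanSpace.dist_eq, Real.sq_sqrt (by positivity)]
  simp [Real.dist_eq, sq_abs]

/-- Quadratic decay. -/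
lemma decay (H : LocSol τ ε u O) {z : Pl} {s δ α : ℝ} (hD : closedBall z s ⊆ O)
    (hα : 0 < α) (hf : ∀ t : ℝ, |t| ≤ 1 → α * |t| ≤ |fτ τ t|) (hs : 0 < s)
    (hδ : 0 < δ) (hδ1 : δ ≤ 1) (hu : ∀ y ∈ closedBall z s, |u y| ≤ δ) :
    |u z| ≤ 4 * δ * ε ^ 2 / (α * s ^ 2) := by
  have hε := H.εpos
  have key : ∀ σ : ℝ, (σ = 1 ∨ σ = -1) → σ * u z ≤ 4 * δ * ε ^ 2 / (α * s ^ 2) := by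
    intro σ hσ
    have hσ2 : σ * σ = 1 := by rcases hσ with h | h <;> rw [h] <;> norm_num
    have hσa : |σ| = 1 := by rcases hσ with h | h <;> rw [h] <;> norm_num
    set φ : Pl → ℝ := fun y => (-(δ / s ^ 2)) * ((y 0 - z 0) ^ 2 + (y 1 - z 1) ^ 2) with hφ
    have hφc : ContDiff ℝ (⊤ : ℕ∞) φ := by rw [hφ]; fun_prop
    have hcu : ContinuousOn u (closedBall z s) := H.smooth.continuousOn.mono hD
    have hcont : ContinuousOn (fun y => σ * u y + φ y) (closedBall z s) :=
      (continuousOn_const.mul hcu).add hφc.continuous.continuousOn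
    obtain ⟨y, hy, hmax⟩ := (isCompact_closedBall z s).exists_isMaxOn
      ⟨z, mem_closedBall_self hs.le⟩ hcont
    have hz : σ * u z + φ z ≤ σ * u y + φ y := hmax (mem_closedBall_self hs.le)
    have hφz : φ z = 0 := by simp [hφ]
    have hφy : φ y = -(δ / s ^ 2) * dist y z ^ 2 := by rw [hφ]; simp only; rw [normsq]
    have hφy0 : φ y ≤ 0 := by
      rw [hφy]
      have : 0 ≤ δ / s ^ 2 * dist y z ^ 2 := by positivity
      linarith
    have hR : 0 ≤ 4 * δ * ε ^ 2 / (α * s ^ 2) := by positivity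
    have hle : σ * u y ≤ |u y| := by
      calc σ * u y ≤ |σ * u y| := le_abs_self _
        _ = _ := by rw [abs_mul, hσa, one_mul]
    by_cases hpos : σ * u y ≤ 0
    · linarith
    push Not at hpos
    by_cases hys : dist y z = s
    · have : φ y = - δ := by rw [hφy, hys]; field_simp
      have := hu y hy
      linarith
    have hyb : y ∈ ball z s := lt_of_le_of_ne hy hys
    have hm : IsLocalMax (fun y => σ * u y + φ y) y := by
      filter_upwards [isOpen_ball.mem_nhds hyb] with w hw
      exact hmax (ball_subset_closedBall hw)
    have h1 := lap_nonpos (hcont.continuousAt (mem_of_superset (isOpen_ball.mem_nhds hyb) ball_subset_closedBall)) hm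
    rw [H.lap_affine (hD hy) σ hφc, hφ, lap_quad] at h1
    have hfy : α * |u y| ≤ - σ * fτ τ (u y) := by
      refine (hf _ ((hu y hy).trans hδ1)).trans (le_of_eq ?_)
      rcases hσ with h | h
      · have : 0 < u y := by rw [h] at hpos; linarith
        rw [abs_of_neg (ftau_neg H.τpos this), h]; ring
      · have : u y < 0 := by rw [h] at hpos; linarith
        rw [abs_of_pos (ftau_pos H.τpos this), h]; ring
    have h2 : (ε^2)⁻¹ * (α * |u y|) ≤ (ε^2)⁻¹ * (- σ * fτ τ (u y)) := by gcongr
    have h3 : (ε^2)⁻¹ * (α * |u y|) ≤ 4 * (δ / s ^ 2) := by nlinarith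
    have h4 : |u y| ≤ 4 * δ * ε ^ 2 / (α * s ^ 2) := by
      rw [inv_mul_eq_div, div_le_iff₀ (by positivity)] at h3
      rw [le_div_iff₀ (by positivity)]
      have : 4 * (δ / s ^ 2) * ε ^ 2 * s ^ 2 = 4 * δ * ε ^ 2 := by field_simp
      calc |u y| * (α * s ^ 2) = (α * |u y|) * s ^ 2 := by ring
        _ ≤ (4 * (δ / s ^ 2) * ε ^ 2) * s ^ 2 := by gcongr
        _ = _ := this
    linarith
  rw [abs_le]
  have h1 := key 1 (Or.inl rfl)
  have h2 := key (-1) (Or.inr rfl)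
  constructor <;> linarith

lemma coord_le (y a : Pl) : y 0 - a 0 ≤ dist y a := by
  have h := normsq y a
  have : (y 0 - a 0) ^ 2 ≤ dist y a ^ 2 := by nlinarith [sq_nonneg (y 1 - a 1)]
  exact (abs_le_of_sq_le_sq' this dist_nonneg).2

/-- Harnack-type lower barrier. -/
lemma harnack (H : LocSol τ ε u O) {a : Pl} {s B A : ℝ} (hD : closedBall a s ⊆ O)
    (hA : 0 < A) (hf : ∀ t : ℝ, |fτ τ t| ≤ A * |t|) (hs : 0 < s) (hB : 0 < B)
    (hu : ∀ y ∈ sphere a s, B < |u y|) :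
    B * Real.exp (-(Real.sqrt A * s / ε)) ≤ |u a| := by
  have hε := H.εpos
  have hcu : ContinuousOn u (closedBall a s) := H.smooth.continuousOn.mono hD
  have hsph : IsPreconnected (sphere a s) := by
    apply isPreconnected_sphere
    rw [← Module.finrank_eq_rank]
    simp
  have hsign : ∃ σ : ℝ, (σ = 1 ∨ σ = -1) ∧ ∀ y ∈ sphere a s, B < σ * u y := by
    by_cases h1 : ∀ y ∈ sphere a s, 0 < u y
    · refine ⟨1, Or.inl rfl, fun y hy => ?_⟩
      have := hu y hy
      rw [abs_of_pos (h1 y hy)] at this; linarith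
    push Not at h1
    obtain ⟨y1, hy1, hy1'⟩ := h1
    refine ⟨-1, Or.inr rfl, fun y hy => ?_⟩
    have hneg : u y < 0 := by
      by_contra hcon
      push Not at hcon
      have := hsph.intermediate_value hy1 hy (hcu.mono sphere_subset_closedBall)
      obtain ⟨w, hw, hw0⟩ := this (show (0:ℝ) ∈ Icc (u y1) (u y) from ⟨hy1', hcon⟩)
      have := hu w hw
      rw [hw0] at this; simp at this; linarith
    have := hu y hy
    rw [abs_of_neg hneg] at this; linarith
  obtain ⟨σ, hσ, hσu⟩ := hsign
  set b : ℝ := Real.sqrt A / ε with hb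
  have hb2 : b ^ 2 = (ε ^ 2)⁻¹ * A := by
    rw [hb, div_pow, Real.sq_sqrt hA.le]; field_simp
  have hb0 : 0 ≤ b := by positivity
  set φ : Pl → ℝ := fun y => B * Real.exp (b * (y 0 - (a 0 + s))) with hφ
  have hφc : ContDiff ℝ (⊤ : ℕ∞) φ := by rw [hφ]; fun_prop
  have hφB : ∀ y ∈ closedBall a s, φ y ≤ B := by
    intro y hy
    have h1 := coord_le y a
    rw [mem_closedBall] at hy
    have : Real.exp (b * (y 0 - (a 0 + s))) ≤ 1 := by
      rw [Real.exp_le_one_iff]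
      apply mul_nonpos_of_nonneg_of_nonpos hb0; linarith
    calc φ y ≤ B * 1 := mul_le_mul_of_nonneg_left this hB.le
      _ = B := mul_one B
  have hcont : ContinuousOn (fun y => (-σ) * u y + φ y) (closedBall a s) :=
    (continuousOn_const.mul hcu).add hφc.continuous.continuousOn
  obtain ⟨y, hy, hmax⟩ := (isCompact_closedBall a s).exists_isMaxOn
    ⟨a, mem_closedBall_self hs.le⟩ hcont
  have ha : (-σ) * u a + φ a ≤ (-σ) * u y + φ y := hmax (mem_closedBall_self hs.le)
  have hσa : |σ| = 1 := by rcases hσ with h | h <;> rw [h] <;> norm_num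
  have hle : ∀ x, σ * u x ≤ |u x| := by
    intro x
    calc σ * u x ≤ |σ * u x| := le_abs_self _
      _ = _ := by rw [abs_mul, hσa, one_mul]
  have hφa : φ a = B * Real.exp (-(Real.sqrt A * s / ε)) := by
    rw [hφ, hb]; simp only; congr 2; ring
  rw [← hφa]
  suffices hfin : (-σ) * u y + φ y ≤ 0 by linarith [hle a]
  by_contra hcon
  push Not at hcon
  have hyb : y ∈ ball a s := by
    refine lt_of_le_of_ne (mem_closedBall.1 hy) fun hys => ?_
    have h1 := hσu y hys
    have h2 := hφB y hy
    linarith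
  have hm : IsLocalMax (fun y => (-σ) * u y + φ y) y := by
    filter_upwards [isOpen_ball.mem_nhds hyb] with w hw
    exact hmax (ball_subset_closedBall hw)
  have h1 := lap_nonpos (hcont.continuousAt (mem_of_superset (isOpen_ball.mem_nhds hyb) ball_subset_closedBall)) hm
  rw [H.lap_affine (hD hy) (-σ) hφc, hφ, lap_exp] at h1
  have hφpos : 0 < φ y := by rw [hφ]; positivity
  change - -σ * ((ε ^ 2)⁻¹ * fτ τ (u y)) + b ^ 2 * φ y ≤ 0 at h1
  rw [hb2] at h1
  have hi : 0 < (ε ^ 2)⁻¹ := by positivity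
  have h2 : (ε ^ 2)⁻¹ * (σ * fτ τ (u y) + A * φ y) ≤ 0 := by linarith
  have h3 : σ * fτ τ (u y) + A * φ y ≤ 0 := by
    by_contra h; push Not at h
    have := mul_pos hi h
    linarith
  have hAφ : 0 < A * φ y := by positivity
  rcases le_or_gt (σ * u y) 0 with h | h
  · have : 0 ≤ σ * fτ τ (u y) := by
      rcases eq_or_ne (u y) 0 with h0 | h0
      · rw [h0]; simp [fτ]
      rcases hσ with h' | h'
      · rw [h'] at h ⊢
        have : u y < 0 := lt_of_le_of_ne (by linarith) h0
        linarith [ftau_pos H.τpos this]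
      · rw [h'] at h ⊢
        have : 0 < u y := lt_of_le_of_ne (by linarith) h0.symm
        linarith [ftau_neg H.τpos this]
    linarith
  · have h4 : |u y| = σ * u y := by
      rw [← abs_of_pos h, abs_mul, hσa, one_mul]
    have h5 := hf (u y)
    have h6 : -(σ * fτ τ (u y)) ≤ |fτ τ (u y)| := by
      calc -(σ * fτ τ (u y)) ≤ |σ * fτ τ (u y)| := neg_le_abs _
        _ = _ := by rw [abs_mul, hσa, one_mul]
    rw [h4] at h5
    have h7 : σ * u y < φ y := by linarith
    nlinarith

end LocSol

/-- the plane `ℝ × ℝ` as `Pl`. -/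
def EE (q : ℝ × ℝ) : Pl := q.1 • EuclideanSpace.single 0 (1:ℝ) + q.2 • EuclideanSpace.single 1 (1:ℝ)

@[simp] lemma EE_zero_coord (q : ℝ × ℝ) : EE q 0 = q.1 := by simp [EE]
@[simp] lemma EE_one_coord (q : ℝ × ℝ) : EE q 1 = q.2 := by simp [EE]

@[fun_prop]
lemma EE_cont : Continuous EE := by unfold EE; fun_prop

lemma pl_ext {x y : Pl} (h0 : x 0 = y 0) (h1 : x 1 = y 1) : x = y := by
  ext i; fin_cases i
  · exact h0
  · exact h1

lemma clm_EE (T : Pl →L[ℝ] ℝ) (q : ℝ × ℝ) :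
    T (EE q) = q.1 * T (EuclideanSpace.single 0 (1:ℝ)) + q.2 * T (EuclideanSpace.single 1 (1:ℝ)) := by
  simp [EE]

lemma dist_add_EE (c : Pl) (q : ℝ × ℝ) : dist (c + EE q) c ^ 2 = q.1 ^ 2 + q.2 ^ 2 := by
  rw [← LocSol.normsq]; simp

/-- circle parametrization -/
def circ (c : Pl) (s θ : ℝ) : Pl := c + EE (s * Real.cos θ, s * Real.sin θ)

lemma circ_mem (c : Pl) {s : ℝ} (hs : 0 ≤ s) (θ : ℝ) : dist (circ c s θ) c = s := by
  have h := dist_add_EE c (s * Real.cos θ, s * Real.sin θ)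
  have : (s * Real.cos θ) ^ 2 + (s * Real.sin θ) ^ 2 = s ^ 2 := by
    have := Real.sin_sq_add_cos_sq θ
    nlinarith
  simp only at h
  rw [this] at h
  exact (pow_left_inj₀ dist_nonneg hs (by norm_num)).1 h

lemma exists_circ {c y : Pl} {s : ℝ} (hy : y ∈ sphere c s) :
    ∃ θ ∈ Ioc (-π) π, y = circ c s θ := by
  set z : ℂ := ⟨y 0 - c 0, y 1 - c 1⟩ with hz
  have hn : ‖z‖ = s := by
    have h := LocSol.normsq y c
    rw [mem_sphere.1 hy] at h
    have hs : 0 ≤ s := by rw [← mem_sphere.1 hy]; exact dist_nonneg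
    have : ‖z‖ ^ 2 = s ^ 2 := by
      rw [← h, ← Complex.normSq_eq_norm_sq, Complex.normSq_apply]; simp [hz]; ring
    exact (pow_left_inj₀ (norm_nonneg _) hs (by norm_num)).1 this
  refine ⟨z.arg, Complex.arg_mem_Ioc z, ?_⟩
  have h1 := Complex.norm_mul_cos_arg z
  have h2 := Complex.norm_mul_sin_arg z
  rw [hn] at h1 h2
  unfold circ
  rw [h1, h2]
  apply pl_ext <;> simp [hz]

lemma circ_hasDerivAt (c : Pl) (s θ : ℝ) :
    HasDerivAt (circ c s) (EE (s * -Real.sin θ, s * Real.cos θ)) θ := by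
  unfold circ EE
  have h1 := ((Real.hasDerivAt_cos θ).const_mul s).smul_const (EuclideanSpace.single (0 : Fin 2) (1:ℝ))
  have h2 := ((Real.hasDerivAt_sin θ).const_mul s).smul_const (EuclideanSpace.single (1 : Fin 2) (1:ℝ))
  exact (h1.add h2).const_add c

lemma circle_lower {u : Pl → ℝ} {O : Set Pl} (hO : IsOpen O) (hu : ContDiffOn ℝ (⊤ : ℕ∞) u O)
    {P p : ℝ → ℝ} (hP : ∀ t, HasDerivAt P (p t) t) (hp : Continuous p) (hp0 : ∀ t, 0 ≤ p t)
    {c : Pl} {s κ : ℝ} (hs : 0 ≤ s) (hD : sphere c s ⊆ O)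
    (hk : ∃ y₁ ∈ sphere c s, ∃ y₂ ∈ sphere c s, κ ≤ P (u y₁) - P (u y₂)) :
    κ ≤ ∫ θ in Ioc (-π) π, s * (p (u (circ c s θ)) * Real.sqrt (gradSq u (circ c s θ))) := by
  obtain ⟨y₁, hy₁, y₂, hy₂, hk⟩ := hk
  obtain ⟨θ₁, hθ₁, rfl⟩ := exists_circ hy₁
  obtain ⟨θ₂, hθ₂, rfl⟩ := exists_circ hy₂
  have hmem : ∀ θ, circ c s θ ∈ O := fun θ => hD (circ_mem c hs θ)
  have hcc : Continuous (circ c s) := by unfold circ; fun_prop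
  have hpd : ∀ i, Continuous fun θ => pd u i (circ c s θ) := fun i =>
    (pd_contDiffOn hO hu i).continuousOn.comp_continuous hcc hmem
  have huc : Continuous fun θ => u (circ c s θ) := hu.continuousOn.comp_continuous hcc hmem
  set G' : ℝ → ℝ := fun θ => p (u (circ c s θ)) *
    ((s * -Real.sin θ) * pd u 0 (circ c s θ) + (s * Real.cos θ) * pd u 1 (circ c s θ)) with hG'
  have hG : ∀ θ, HasDerivAt (fun θ => P (u (circ c s θ))) (G' θ) θ := by
    intro θ
    have hd := diffAt_of hO hu (hmem θ)
    have h1 := hd.hasFDerivAt.comp_hasDerivAt θ (circ_hasDerivAt c s θ)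
    have h2 := (hP (u (circ c s θ))).comp θ h1
    rw [clm_EE] at h2
    rw [← pd_eq_fderiv hd, ← pd_eq_fderiv hd] at h2
    exact h2
  have hG'c : Continuous G' := by
    exact (hp.comp huc).mul (((continuous_const.mul Real.continuous_sin.neg).mul (hpd 0)).add
      ((continuous_const.mul Real.continuous_cos).mul (hpd 1)))
  have hbound : ∀ θ, |G' θ| ≤ s * (p (u (circ c s θ)) * Real.sqrt (gradSq u (circ c s θ))) := by
    intro θ
    rw [hG']; simp only
    rw [abs_mul, abs_of_nonneg (hp0 _)]
    have : |(s * -Real.sin θ) * pd u 0 (circ c s θ) + (s * Real.cos θ) * pd u 1 (circ c s θ)|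
        ≤ s * Real.sqrt (gradSq u (circ c s θ)) := by
      have e : (s * -Real.sin θ) * pd u 0 (circ c s θ) + (s * Real.cos θ) * pd u 1 (circ c s θ)
        = s * (-Real.sin θ * pd u 0 (circ c s θ) + Real.cos θ * pd u 1 (circ c s θ)) := by ring
      rw [e, abs_mul, abs_of_nonneg hs]
      gcongr
      apply Real.abs_le_sqrt
      unfold gradSq
      have h1 := Real.sin_sq_add_cos_sq θ
      set a := pd u 0 (circ c s θ)
      set b := pd u 1 (circ c s θ)
      have : a ^ 2 + b ^ 2 = (a^2+b^2) * (Real.sin θ ^ 2 + Real.cos θ ^ 2) := by rw [h1]; ring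
      rw [this]
      nlinarith [sq_nonneg (Real.cos θ * a + Real.sin θ * b)]
    calc _ ≤ p (u (circ c s θ)) * (s * Real.sqrt (gradSq u (circ c s θ))) :=
          mul_le_mul_of_nonneg_left this (hp0 _)
      _ = _ := by ring
  have hgc : Continuous fun θ => s * (p (u (circ c s θ)) * Real.sqrt (gradSq u (circ c s θ))) := by
    exact continuous_const.mul ((hp.comp huc).mul
      (Real.continuous_sqrt.comp (((hpd 0).pow 2).add ((hpd 1).pow 2))))
  have hFTC := intervalIntegral.integral_eq_sub_of_hasDerivAt (a := θ₂) (b := θ₁)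
    (fun θ _ => hG θ) (hG'c.intervalIntegrable _ _)
  calc κ ≤ _ := hk
    _ = ∫ θ in θ₂..θ₁, G' θ := hFTC.symm
    _ ≤ ‖∫ θ in θ₂..θ₁, G' θ‖ := Real.le_norm_self _
    _ ≤ ∫ θ in uIoc θ₂ θ₁, ‖G' θ‖ := intervalIntegral.norm_integral_le_integral_norm_uIoc
    _ ≤ ∫ θ in Ioc (-π) π, ‖G' θ‖ := by
        apply setIntegral_mono_set
        · exact (hG'c.norm.integrableOn_Icc (a := -π) (b := π)).mono_set Ioc_subset_Icc_self
        · exact Eventually.of_forall fun _ => norm_nonneg _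
        · apply LE.le.eventuallyLE
          intro θ hθ
          rw [mem_uIoc] at hθ
          rcases hθ with h | h
          · exact ⟨hθ₂.1.trans h.1, h.2.trans hθ₁.2⟩
          · exact ⟨hθ₁.1.trans h.1, h.2.trans hθ₂.2⟩
    _ ≤ _ := by
        apply setIntegral_mono
        · exact (hG'c.norm.integrableOn_Icc (a := -π) (b := π)).mono_set Ioc_subset_Icc_self
        · exact (hgc.integrableOn_Icc (a := -π) (b := π)).mono_set Ioc_subset_Icc_self
        · exact hbound

lemma annulus_lower {u : Pl → ℝ} {O : Set Pl} (hO : IsOpen O) (hu : ContDiffOn ℝ (⊤ : ℕ∞) u O)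
    {P p : ℝ → ℝ} (hP : ∀ t, HasDerivAt P (p t) t) (hp : Continuous p) (hp0 : ∀ t, 0 ≤ p t)
    {c : Pl} {s₁ s₂ κ : ℝ} (hs : 0 < s₁) (hs12 : s₁ ≤ s₂) (hD : closedBall c s₂ ⊆ O) (hκ : 0 ≤ κ)
    (hk : ∀ s ∈ Icc s₁ s₂, ∃ y₁ ∈ sphere c s, ∃ y₂ ∈ sphere c s, κ ≤ P (u y₁) - P (u y₂)) :
    κ * (s₂ - s₁) ≤ ∫ q in {q : ℝ × ℝ | q.1 ^ 2 + q.2 ^ 2 ≤ s₂ ^ 2},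
      p (u (c + EE q)) * Real.sqrt (gradSq u (c + EE q)) := by
  set D : Set (ℝ × ℝ) := {q : ℝ × ℝ | q.1 ^ 2 + q.2 ^ 2 ≤ s₂ ^ 2} with hDdef
  set g : ℝ × ℝ → ℝ := fun q => p (u (c + EE q)) * Real.sqrt (gradSq u (c + EE q)) with hg
  have hs2 : 0 ≤ s₂ := hs.le.trans hs12
  have hDmem : ∀ q ∈ D, c + EE q ∈ O := by
    intro q hq
    apply hD
    rw [mem_closedBall]
    have := dist_add_EE c q
    exact (pow_le_pow_iff_left₀ dist_nonneg hs2 (by norm_num : (2:ℕ) ≠ 0)).1 (this.le.trans hq)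
  have hDclosed : IsClosed D := isClosed_le (by fun_prop) (by fun_prop)
  have hDcomp : IsCompact D := by
    have hc : IsCompact (Icc (-s₂) s₂ ×ˢ Icc (-s₂) s₂) := isCompact_Icc.prod isCompact_Icc
    refine hc.of_isClosed_subset hDclosed ?_
    intro q hq
    have hq' : q.1 ^ 2 + q.2 ^ 2 ≤ s₂ ^ 2 := hq
    have h1 := abs_le_of_sq_le_sq' (show q.1 ^ 2 ≤ s₂ ^ 2 by nlinarith [sq_nonneg q.2]) hs2
    have h2 := abs_le_of_sq_le_sq' (show q.2 ^ 2 ≤ s₂ ^ 2 by nlinarith [sq_nonneg q.1]) hs2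
    exact ⟨h1, h2⟩
  have hgc : ContinuousOn g D := by
    have hEc : ContinuousOn (fun q => c + EE q) D := by fun_prop
    have h0 := (pd_contDiffOn hO hu 0).continuousOn.comp hEc hDmem
    have h1 := (pd_contDiffOn hO hu 1).continuousOn.comp hEc hDmem
    have h2 := hp.comp_continuousOn (hu.continuousOn.comp hEc hDmem)
    exact h2.mul (Real.continuous_sqrt.comp_continuousOn ((h0.pow 2).add (h1.pow 2)))
  have hg0 : ∀ q, 0 ≤ g q := fun q => mul_nonneg (hp0 _) (Real.sqrt_nonneg _)
  have hgi : IntegrableOn g D := hgc.integrableOn_compact hDcomp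
  rw [← ENNReal.ofReal_le_ofReal_iff (integral_nonneg hg0),
    ofReal_integral_eq_lintegral_ofReal hgi (Eventually.of_forall hg0),
    ← lintegral_indicator hDclosed.measurableSet, ← lintegral_comp_polarCoord_symm]
  have hsub : Icc s₁ s₂ ×ˢ Ioo (-π) π ⊆ polarCoord.target := by
    rintro ⟨s, θ⟩ ⟨h1, h2⟩
    rw [polarCoord_target]
    exact ⟨lt_of_lt_of_le hs h1.1, h2⟩
  refine le_trans ?_ (lintegral_mono_set hsub)
  have e : ∀ q ∈ Icc s₁ s₂ ×ˢ Ioo (-π) π,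
      ENNReal.ofReal q.1 • D.indicator (fun q => ENNReal.ofReal (g q)) (polarCoord.symm q)
        = ENNReal.ofReal (q.1 * (p (u (circ c q.1 q.2)) * Real.sqrt (gradSq u (circ c q.1 q.2)))) := by
    rintro ⟨s, θ⟩ ⟨hsm, -⟩
    have hs0 : 0 ≤ s := hs.le.trans hsm.1
    have hq : polarCoord.symm (s, θ) = (s * Real.cos θ, s * Real.sin θ) := rfl
    have hqD : polarCoord.symm (s, θ) ∈ D := by
      rw [hq]; change (s * Real.cos θ) ^ 2 + (s * Real.sin θ) ^ 2 ≤ s₂ ^ 2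
      have := Real.sin_sq_add_cos_sq θ
      have h3 : s ^ 2 ≤ s₂ ^ 2 := by gcongr; exact hsm.2
      nlinarith
    rw [indicator_of_mem hqD, hq, smul_eq_mul, ← ENNReal.ofReal_mul hs0]
    rfl
  rw [setLIntegral_congr_fun (measurableSet_Icc.prod measurableSet_Ioo) e]
  have hFc : ContinuousOn (fun q : ℝ × ℝ =>
      q.1 * (p (u (circ c q.1 q.2)) * Real.sqrt (gradSq u (circ c q.1 q.2))))
      (Icc s₁ s₂ ×ˢ Ioo (-π) π) := by
    have hEc : ContinuousOn (fun q : ℝ × ℝ => circ c q.1 q.2) (Icc s₁ s₂ ×ˢ Ioo (-π) π) := by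
      unfold circ; fun_prop
    have hm : MapsTo (fun q : ℝ × ℝ => circ c q.1 q.2) (Icc s₁ s₂ ×ˢ Ioo (-π) π) O := by
      rintro ⟨s, θ⟩ ⟨hsm, -⟩
      apply hD
      rw [mem_closedBall, circ_mem c (hs.le.trans hsm.1)]
      exact hsm.2
    have h0 := (pd_contDiffOn hO hu 0).continuousOn.comp hEc hm
    have h1 := (pd_contDiffOn hO hu 1).continuousOn.comp hEc hm
    have h2 := hp.comp_continuousOn (hu.continuousOn.comp hEc hm)
    exact continuousOn_fst.mul
      (h2.mul (Real.continuous_sqrt.comp_continuousOn ((h0.pow 2).add (h1.pow 2))))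
  have hFm := (hFc.aemeasurable (measurableSet_Icc.prod measurableSet_Ioo)
    (μ := (volume : Measure (ℝ × ℝ)))).ennreal_ofReal
  rw [Measure.volume_eq_prod, ← Measure.prod_restrict] at hFm ⊢
  rw [lintegral_prod _ hFm]
  have hin : ∀ s ∈ Icc s₁ s₂, ENNReal.ofReal κ ≤ ∫⁻ θ in Ioo (-π) π,
      ENNReal.ofReal (s * (p (u (circ c s θ)) * Real.sqrt (gradSq u (circ c s θ)))) := by
    intro s hsm
    have hs0 : 0 ≤ s := hs.le.trans hsm.1
    have hsub : sphere c s ⊆ O := sphere_subset_closedBall.trans ((closedBall_subset_closedBall hsm.2).trans hD)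
    have h1 := circle_lower hO hu hP hp hp0 hs0 hsub (hk s hsm)
    rw [Measure.restrict_congr_set Ioo_ae_eq_Ioc]
    by_cases hi : IntegrableOn (fun θ => s * (p (u (circ c s θ)) * Real.sqrt (gradSq u (circ c s θ)))) (Ioc (-π) π)
    · rw [← ofReal_integral_eq_lintegral_ofReal hi]
      · exact ENNReal.ofReal_le_ofReal h1
      · exact Eventually.of_forall fun θ => mul_nonneg hs0 (mul_nonneg (hp0 _) (Real.sqrt_nonneg _))
    · rw [integral_undef hi] at h1
      rw [ENNReal.ofReal_of_nonpos h1]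
      exact bot_le
  calc ENNReal.ofReal (κ * (s₂ - s₁)) = ∫⁻ s in Icc s₁ s₂, ENNReal.ofReal κ := by
        rw [setLIntegral_const, Real.volume_Icc, ENNReal.ofReal_mul hκ]
    _ ≤ _ := setLIntegral_mono' measurableSet_Icc hin

/-! ### Auxiliary truncation -/

def hd (t : ℝ) : ℝ := max 0 (1 - t ^ 2)

def hh (t : ℝ) : ℝ := ∫ s in (0:ℝ)..t, hd s

lemma hd_cont : Continuous hd := by unfold hd; fun_prop

lemma hd_nonneg (t : ℝ) : 0 ≤ hd t := le_max_left _ _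

lemma hd_zero {t : ℝ} (ht : 1 ≤ |t|) : hd t = 0 := by
  unfold hd
  apply max_eq_left
  have : 1 ≤ t ^ 2 := by rw [← sq_abs]; nlinarith
  linarith

lemma hd_pos {t : ℝ} (ht : |t| < 1) : 0 < hd t := by
  unfold hd
  apply lt_max_of_lt_right
  have : t ^ 2 < 1 := by rw [← sq_abs]; nlinarith [abs_nonneg t]
  linarith

lemma hh_deriv (t : ℝ) : HasDerivAt hh (hd t) t :=
  hd_cont.integral_hasStrictDerivAt 0 t |>.hasDerivAt

lemma hh_cont : Continuous hh := continuous_iff_continuousAt.2 fun t => (hh_deriv t).continuousAt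

lemma hh_mono : Monotone hh :=
  monotone_of_deriv_nonneg (fun t => (hh_deriv t).differentiableAt)
    fun t => by rw [(hh_deriv t).deriv]; exact hd_nonneg t

lemma hh_zero : hh 0 = 0 := by simp [hh]

lemma hh_ge {t : ℝ} (ht : 1 ≤ t) : hh t = hh 1 := by
  unfold hh
  rw [← intervalIntegral.integral_add_adjacent_intervals (b := 1) (hd_cont.intervalIntegrable _ _)
    (hd_cont.intervalIntegrable _ _)]
  have : ∫ s in (1:ℝ)..t, hd s = ∫ s in (1:ℝ)..t, (0:ℝ) := by
    apply intervalIntegral.integral_congr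
    intro s hs
    rw [uIcc_of_le ht] at hs
    exact hd_zero (hs.1.trans (le_abs_self s))
  rw [this]; simp

lemma hh_le {t : ℝ} (ht : t ≤ -1) : hh t = hh (-1) := by
  unfold hh
  rw [← intervalIntegral.integral_add_adjacent_intervals (b := -1) (hd_cont.intervalIntegrable _ _)
    (hd_cont.intervalIntegrable _ _)]
  have : ∫ s in (-1:ℝ)..t, hd s = ∫ s in (-1:ℝ)..t, (0:ℝ) := by
    apply intervalIntegral.integral_congr
    intro s hs
    rw [uIcc_of_ge ht] at hs
    apply hd_zero
    have := neg_abs_le s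
    have := hs.2
    linarith
  rw [this]; simp

lemma hh_bound (t : ℝ) : |hh t| ≤ |hh 1| + |hh (-1)| := by
  have h1 : hh t ≤ hh 1 := by
    rcases le_total t 1 with h | h
    · exact hh_mono h
    · exact (hh_ge h).le
  have h2 : hh (-1) ≤ hh t := by
    rcases le_total (-1) t with h | h
    · exact hh_mono h
    · exact (hh_le h).ge
  rw [abs_le]
  have := abs_nonneg (hh 1)
  have := abs_nonneg (hh (-1))
  have := le_abs_self (hh 1)
  have := neg_abs_le (hh (-1))
  constructor <;> linarith

lemma hh_pos {t : ℝ} (h0 : 0 < t) (h1 : t < 1) : 0 < hh t := by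
  apply intervalIntegral.intervalIntegral_pos_of_pos_on (hd_cont.intervalIntegrable _ _) _ h0
  intro s hs
  apply hd_pos
  rw [abs_of_pos hs.1]
  exact hs.2.trans h1

lemma hh_neg {t : ℝ} (h0 : t < 0) (h1 : -1 < t) : hh t < 0 := by
  unfold hh
  rw [intervalIntegral.integral_symm, neg_lt_zero]
  apply intervalIntegral.intervalIntegral_pos_of_pos_on (hd_cont.intervalIntegrable _ _) _ h0
  intro s hs
  apply hd_pos
  rw [abs_of_neg hs.2]
  linarith [hs.1]

lemma fh_nonneg {τ : ℝ} (hτ : 0 < τ) (t : ℝ) : 0 ≤ - (fτ τ t * hh t) := by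
  rcases lt_trichotomy t 0 with h | h | h
  · have h1 := ftau_pos hτ h
    have h2 := hh_mono h.le
    rw [hh_zero] at h2
    nlinarith
  · rw [h, hh_zero]; simp
  · have h1 := ftau_neg hτ h
    have h2 := hh_mono h.le
    rw [hh_zero] at h2
    nlinarith

/-- weight of the interface cost -/
def pw (τ t : ℝ) : ℝ := Real.sqrt (hd t * (-(fτ τ t * hh t)))

def Pw (τ t : ℝ) : ℝ := ∫ s in (0:ℝ)..t, pw τ s

lemma pw_cont {τ : ℝ} (hτ : 0 < τ) : Continuous (pw τ) := by
  unfold pw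
  have := ftau_cont hτ
  have := hh_cont
  have := hd_cont
  fun_prop

lemma pw_nonneg (τ t : ℝ) : 0 ≤ pw τ t := Real.sqrt_nonneg _

lemma Pw_deriv {τ : ℝ} (hτ : 0 < τ) (t : ℝ) : HasDerivAt (Pw τ) (pw τ t) t :=
  (pw_cont hτ).integral_hasStrictDerivAt 0 t |>.hasDerivAt

lemma Pw_mono {τ : ℝ} (hτ : 0 < τ) : Monotone (Pw τ) :=
  monotone_of_deriv_nonneg (fun t => (Pw_deriv hτ t).differentiableAt)
    fun t => by rw [(Pw_deriv hτ t).deriv]; exact pw_nonneg τ t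

lemma pw_pos {τ t : ℝ} (hτ : 0 < τ) (ht : |t| < 1) (h0 : t ≠ 0) : 0 < pw τ t := by
  unfold pw
  apply Real.sqrt_pos.2
  apply mul_pos (hd_pos ht)
  obtain ⟨h1, h2⟩ := abs_lt.1 ht
  rcases lt_or_gt_of_ne h0 with h | h
  · have := mul_neg_of_pos_of_neg (ftau_pos hτ h) (hh_neg h h1)
    linarith
  · have := mul_neg_of_neg_of_pos (ftau_neg hτ h) (hh_pos h h2)
    linarith

lemma Pw_lt {τ a b : ℝ} (hτ : 0 < τ) (hab : a < b) (h : ∀ t ∈ Ioo a b, |t| < 1 ∧ t ≠ 0) :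
    Pw τ a < Pw τ b := by
  have : Pw τ b - Pw τ a = ∫ s in a..b, pw τ s := by
    unfold Pw
    rw [intervalIntegral.integral_interval_sub_left ((pw_cont hτ).intervalIntegrable _ _)
      ((pw_cont hτ).intervalIntegrable _ _)]
  have h2 : 0 < ∫ s in a..b, pw τ s :=
    intervalIntegral.intervalIntegral_pos_of_pos_on ((pw_cont hτ).intervalIntegrable _ _)
      (fun s hs => pw_pos hτ (h s hs).1 (h s hs).2) hab
  linarith

/-- AM-GM: the interface cost is controlled by the energy density. -/
lemma pw_amgm {τ ε : ℝ} (hτ : 0 < τ) (hε : 0 < ε) (t g : ℝ) (hg : 0 ≤ g) :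
    pw τ t * Real.sqrt g ≤ ε / 2 * (hd t * g + (ε ^ 2)⁻¹ * (-(fτ τ t * hh t))) := by
  have h1 := hd_nonneg t
  have h2 := fh_nonneg hτ t
  set W := -(fτ τ t * hh t)
  have e : pw τ t = Real.sqrt (hd t) * Real.sqrt W := Real.sqrt_mul h1 W
  have e1 := Real.sq_sqrt h1
  have e2 := Real.sq_sqrt h2
  have e3 := Real.sq_sqrt hg
  rw [e]
  set x := Real.sqrt (hd t)
  set y := Real.sqrt W
  set z := Real.sqrt g
  rw [← e1, ← e2, ← e3]
  have h3 : (ε ^ 2)⁻¹ * y ^ 2 = (y / ε) ^ 2 := by field_simp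
  rw [h3]
  have h4 : x * y * z = ε * ((x * z) * (y / ε)) := by field_simp
  rw [h4]
  have : (x * z) * (y / ε) ≤ ((x*z)^2 + (y / ε)^2)/2 := by nlinarith [sq_nonneg (x * z - y / ε)]
  calc ε * ((x * z) * (y / ε)) ≤ ε * (((x*z)^2 + (y / ε)^2)/2) := by gcongr
    _ = _ := by ring

/-! ### The periodic singular fields -/

def SS (p x : Pl) : ℝ := Real.sin (π * (x 0 - p 0)) ^ 2 + Real.sin (π * (x 1 - p 1)) ^ 2

def DD (p : Pl) (i : Fin 2) (x : Pl) : ℝ := π / 2 * Real.sin (2 * π * (x i - p i)) / SS p x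

lemma lattice_coord {v : Pl} : v ∈ unitLattice ↔ ∃ a b : ℤ, v 0 = a ∧ v 1 = b := by
  constructor
  · rintro ⟨a, b, rfl⟩
    exact ⟨a, b, by simp, by simp⟩
  · rintro ⟨a, b, h0, h1⟩
    refine ⟨a, b, pl_ext ?_ ?_⟩
    · simp [h0]
    · simp [h1]

lemma SS_eq_zero_iff (p x : Pl) : SS p x = 0 ↔ ∃ v ∈ unitLattice, x = p + v := by
  unfold SS
  constructor
  · intro h
    have h0 : Real.sin (π * (x 0 - p 0)) = 0 := by nlinarith [sq_nonneg (Real.sin (π * (x 0 - p 0))), sq_nonneg (Real.sin (π * (x 1 - p 1)))]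
    have h1 : Real.sin (π * (x 1 - p 1)) = 0 := by nlinarith [sq_nonneg (Real.sin (π * (x 0 - p 0))), sq_nonneg (Real.sin (π * (x 1 - p 1)))]
    obtain ⟨a, ha⟩ := Real.sin_eq_zero_iff.1 h0
    obtain ⟨b, hb⟩ := Real.sin_eq_zero_iff.1 h1
    refine ⟨x - p, lattice_coord.2 ⟨a, b, ?_, ?_⟩, by simp⟩
    · have : π * (x 0 - p 0) = π * a := by linarith
      simpa using mul_left_cancel₀ Real.pi_ne_zero this
    · have : π * (x 1 - p 1) = π * b := by linarith
      simpa using mul_left_cancel₀ Real.pi_ne_zero this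
  · rintro ⟨v, hv, rfl⟩
    obtain ⟨a, b, h0, h1⟩ := lattice_coord.1 hv
    have e0 : Real.sin (π * ((p + v) 0 - p 0)) = 0 := by
      simp only [PiLp.add_apply, h0]
      rw [show π * (p 0 + a - p 0) = a * π by ring]; exact Real.sin_int_mul_pi a
    have e1 : Real.sin (π * ((p + v) 1 - p 1)) = 0 := by
      simp only [PiLp.add_apply, h1]
      rw [show π * (p 1 + b - p 1) = b * π by ring]; exact Real.sin_int_mul_pi b
    rw [e0, e1]; norm_num

lemma SS_contDiff (p : Pl) : ContDiff ℝ (⊤ : ℕ∞) (SS p) := by unfold SS; fun_prop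

lemma SS_nonneg (p x : Pl) : 0 ≤ SS p x := by unfold SS; positivity

lemma DD_contDiffAt {p x : Pl} (h : SS p x ≠ 0) (i : Fin 2) : ContDiffAt ℝ (⊤ : ℕ∞) (DD p i) x := by
  unfold DD
  refine ContDiffAt.div ?_ (SS_contDiff p).contDiffAt h
  fun_prop

lemma sin_shift (t : ℝ) (a : ℤ) : Real.sin (2 * π * (t + a)) = Real.sin (2 * π * t) := by
  rw [show 2 * π * (t + a) = 2 * π * t + a * (2 * π) by ring]
  exact Real.sin_add_int_mul_two_pi _ _

lemma cos_shift (t : ℝ) (a : ℤ) : Real.cos (2 * π * (t + a)) = Real.cos (2 * π * t) := by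
  rw [show 2 * π * (t + a) = 2 * π * t + a * (2 * π) by ring]
  exact Real.cos_add_int_mul_two_pi _ _

lemma SS_eq (p x : Pl) : SS p x = 1 - (Real.cos (2 * π * (x 0 - p 0)) + Real.cos (2 * π * (x 1 - p 1))) / 2 := by
  unfold SS
  rw [Real.sin_sq_eq_half_sub, Real.sin_sq_eq_half_sub]
  rw [show 2 * (π * (x 0 - p 0)) = 2 * π * (x 0 - p 0) by ring,
    show 2 * (π * (x 1 - p 1)) = 2 * π * (x 1 - p 1) by ring]
  ring

lemma SS_periodic (p x : Pl) {v : Pl} (hv : v ∈ unitLattice) : SS p (x + v) = SS p x := by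
  obtain ⟨a, b, h0, h1⟩ := lattice_coord.1 hv
  rw [SS_eq, SS_eq]
  simp only [PiLp.add_apply, h0, h1]
  rw [show x 0 + (a:ℝ) - p 0 = (x 0 - p 0) + a by ring,
    show x 1 + (b:ℝ) - p 1 = (x 1 - p 1) + b by ring, cos_shift, cos_shift]

lemma DD_periodic (p x : Pl) (i : Fin 2) {v : Pl} (hv : v ∈ unitLattice) :
    DD p i (x + v) = DD p i x := by
  unfold DD
  rw [SS_periodic p x hv]
  obtain ⟨a, b, h0, h1⟩ := lattice_coord.1 hv
  have : ∃ c : ℤ, v i = c := by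
    fin_cases i
    · exact ⟨a, h0⟩
    · exact ⟨b, h1⟩
  obtain ⟨c, hc⟩ := this
  simp only [PiLp.add_apply, hc]
  rw [show x i + (c:ℝ) - p i = (x i - p i) + c by ring, sin_shift]

lemma pd_DD (p x : Pl) (h : SS p x ≠ 0) (i : Fin 2) :
    pd (DD p i) i x = π ^ 2 * ((1 - 2 * Real.sin (π * (x i - p i)) ^ 2) * SS p x
      - 2 * Real.sin (π * (x i - p i)) ^ 2 * (1 - Real.sin (π * (x i - p i)) ^ 2)) / SS p x ^ 2 := by
  apply pd_of_hasDerivAt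
  set T := x i - p i with hT
  obtain ⟨R, hR⟩ : ∃ R : ℝ, ∀ t : ℝ, SS p (x + t • EuclideanSpace.single i (1:ℝ))
      = Real.sin (π * (T + t)) ^ 2 + R := by
    fin_cases i
    · refine ⟨Real.sin (π * (x 1 - p 1)) ^ 2, fun t => ?_⟩
      simp [SS, hT]; ring_nf
    · refine ⟨Real.sin (π * (x 0 - p 0)) ^ 2, fun t => ?_⟩
      simp [SS, hT]; ring_nf
  have hS0 : SS p x = Real.sin (π * T) ^ 2 + R := by simpa using hR 0
  have e : (fun t : ℝ => DD p i (x + t • EuclideanSpace.single i (1:ℝ)))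
      = fun t => π / 2 * Real.sin (2 * π * (T + t)) / (Real.sin (π * (T + t)) ^ 2 + R) := by
    funext t
    unfold DD
    rw [hR t]
    congr 3
    simp [hT]; ring
  rw [e]
  have hl : ∀ c : ℝ, HasDerivAt (fun t : ℝ => c * (T + t)) c 0 := by
    intro c
    simpa using ((hasDerivAt_id (0:ℝ)).const_add T).const_mul c
  have hnum : HasDerivAt (fun t : ℝ => π / 2 * Real.sin (2 * π * (T + t)))
      (π / 2 * (Real.cos (2 * π * T) * (2 * π))) 0 := by
    simpa using ((hl (2 * π)).sin).const_mul (π / 2)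
  have hden : HasDerivAt (fun t : ℝ => Real.sin (π * (T + t)) ^ 2 + R)
      (2 * Real.sin (π * T) * (Real.cos (π * T) * π)) 0 := by
    have := (((hl π).sin).pow 2).add_const R
    simpa using this
  have hden0 : Real.sin (π * (T + 0)) ^ 2 + R ≠ 0 := by rw [add_zero, ← hS0]; exact h
  refine (hnum.div hden hden0).congr_deriv ?_
  simp only [add_zero]
  rw [← hS0]
  congr 1
  have h1 : Real.cos (2 * π * T) = 1 - 2 * Real.sin (π * T) ^ 2 := by
    rw [show 2 * π * T = 2 * (π * T) by ring, Real.cos_two_mul]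
    have := Real.sin_sq_add_cos_sq (π * T)
    linarith
  have h2 : Real.sin (2 * π * T) = 2 * Real.sin (π * T) * Real.cos (π * T) := by
    rw [show 2 * π * T = 2 * (π * T) by ring, Real.sin_two_mul]
  have h3 : 1 - Real.sin (π * T) ^ 2 = Real.cos (π * T) ^ 2 := by
    have := Real.sin_sq_add_cos_sq (π * T)
    linarith
  rw [h1, h2, h3]
  ring

lemma div_DD (p x : Pl) (h : SS p x ≠ 0) :
    |pd (DD p 0) 0 x + pd (DD p 1) 1 x| ≤ 2 * π ^ 2 := by
  rw [pd_DD p x h 0, pd_DD p x h 1]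
  have hS : SS p x = Real.sin (π * (x 0 - p 0)) ^ 2 + Real.sin (π * (x 1 - p 1)) ^ 2 := rfl
  have ha := sq_nonneg (Real.sin (π * (x 0 - p 0)))
  have hb := sq_nonneg (Real.sin (π * (x 1 - p 1)))
  set a := Real.sin (π * (x 0 - p 0)) ^ 2
  set b := Real.sin (π * (x 1 - p 1)) ^ 2
  set S := SS p x
  have e : π ^ 2 * ((1 - 2 * a) * S - 2 * a * (1 - a)) / S ^ 2
      + π ^ 2 * ((1 - 2 * b) * S - 2 * b * (1 - b)) / S ^ 2 = -(2 * π ^ 2) * (2 * a * b / S ^ 2) := by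
    field_simp
    rw [hS]; ring
  rw [e, abs_mul, abs_neg, abs_of_nonneg (show 0 ≤ 2 * π ^ 2 by positivity),
    abs_of_nonneg (by positivity)]
  have hpos : 0 < S ^ 2 := by positivity
  have : 2 * a * b / S ^ 2 ≤ 1 := by
    rw [div_le_one hpos, hS]; nlinarith
  calc _ ≤ 2 * π ^ 2 * 1 := by gcongr
    _ = _ := mul_one _

lemma DD_sing_bound {t s ρ : ℝ} (hρ : 0 < ρ) (hρ1 : ρ ≤ 1 / 10) (h : t ^ 2 + s ^ 2 = ρ ^ 2) :
    |π / 2 * Real.sin (2 * π * t) / (1 - (Real.cos (2 * π * t) + Real.cos (2 * π * s)) / 2)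
      - t / ρ ^ 2| ≤ 4 * π ^ 2 * ρ := by
  have hπ := Real.pi_pos
  have hπ3 := Real.pi_gt_three
  have hπ4 : π < 3.15 := Real.pi_lt_d2
  have ht : |t| ≤ ρ := abs_le_of_sq_le_sq (by nlinarith [sq_nonneg s]) hρ.le
  have hs : |s| ≤ ρ := abs_le_of_sq_le_sq (by nlinarith [sq_nonneg t]) hρ.le
  have ab : ∀ r : ℝ, |2 * π * r| = 2 * π * |r| := fun r => by
    rw [abs_mul, abs_of_pos (by positivity)]
  have b1 : ∀ r : ℝ, |r| ≤ ρ → |2 * π * r| ≤ 1 := fun r hr => by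
    rw [ab]; nlinarith [abs_nonneg r]
  have c1 : ∀ r : ℝ, |r| ≤ ρ → |(1 - Real.cos (2 * π * r)) / 2 - π ^ 2 * r ^ 2| ≤ π ^ 4 * r ^ 4 := by
    intro r hr
    have := Real.cos_bound (b1 r hr)
    rw [ab] at this
    have e4 : |r| ^ 4 = r ^ 4 := by rw [show (4:ℕ) = 2 * 2 by norm_num, pow_mul, sq_abs, ← pow_mul]
    rw [show (2 * π * |r|) ^ 4 = 16 * π ^ 4 * |r| ^ 4 by ring, e4] at this
    have e : (1 - Real.cos (2 * π * r)) / 2 - π ^ 2 * r ^ 2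
      = -(1/2) * (Real.cos (2 * π * r) - (1 - (2 * π * r) ^ 2 / 2)) := by ring
    rw [e, abs_mul]
    have h0 : 0 ≤ π ^ 4 * r ^ 4 := by positivity
    rw [show |(-(1/2) : ℝ)| = 1/2 by norm_num]
    nlinarith
  have d1 : |π / 2 * Real.sin (2 * π * t) - π ^ 2 * t| ≤ π ^ 4 * ρ ^ 3 := by
    have h1 := Real.sin_bound (b1 t ht)
    have h2 : |2 * π * t| ^ 5 ≤ |2 * π * t| ^ 3 :=
      pow_le_pow_of_le_one (abs_nonneg _) (b1 t ht) (by norm_num)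
    have h3 : |2 * π * t| ^ 3 ≤ 8 * π ^ 3 * ρ ^ 3 := by
      rw [ab]
      calc (2 * π * |t|) ^ 3 ≤ (2 * π * ρ) ^ 3 := by gcongr
        _ = _ := by ring
    have h4 : |(2 * π * t) ^ 3| = |2 * π * t| ^ 3 := abs_pow _ _
    have e : π / 2 * Real.sin (2 * π * t) - π ^ 2 * t
      = π / 2 * ((Real.sin (2 * π * t) - (2 * π * t - (2 * π * t) ^ 3 / 6)) - (2 * π * t) ^ 3 / 6) := by ring
    rw [e, abs_mul, abs_of_pos (show 0 < π / 2 by positivity)]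
    have h5 := abs_sub (Real.sin (2 * π * t) - (2 * π * t - (2 * π * t) ^ 3 / 6)) ((2 * π * t) ^ 3 / 6)
    have h6 : |(2 * π * t) ^ 3 / 6| = |2 * π * t| ^ 3 / 6 := by rw [abs_div, h4]; norm_num
    rw [h6] at h5
    have h7 : |Real.sin (2 * π * t) - (2 * π * t - (2 * π * t) ^ 3 / 6) - (2 * π * t) ^ 3 / 6|
      ≤ 2 * π ^ 3 * ρ ^ 3 := by nlinarith [show 0 ≤ π ^ 3 * ρ ^ 3 by positivity]
    calc _ ≤ π / 2 * (2 * π ^ 3 * ρ ^ 3) := by gcongr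
      _ = _ := by ring
  set S := 1 - (Real.cos (2 * π * t) + Real.cos (2 * π * s)) / 2 with hS
  set N := π / 2 * Real.sin (2 * π * t)
  have s1 : |S - π ^ 2 * ρ ^ 2| ≤ π ^ 4 * ρ ^ 4 := by
    have e : S - π ^ 2 * ρ ^ 2 = ((1 - Real.cos (2 * π * t)) / 2 - π ^ 2 * t ^ 2)
      + ((1 - Real.cos (2 * π * s)) / 2 - π ^ 2 * s ^ 2) := by rw [hS, ← h]; ring
    rw [e]
    refine (abs_add_le _ _).trans ((add_le_add (c1 t ht) (c1 s hs)).trans ?_)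
    have : ρ ^ 4 = (t ^ 2 + s ^ 2) ^ 2 := by rw [h]; ring
    rw [this]
    nlinarith [show 0 ≤ π ^ 4 * (t ^ 2 * s ^ 2) by positivity]
  have hπρ : π ^ 2 * ρ ^ 2 ≤ 1 / 2 := by
    have h1 : ρ ^ 2 ≤ 1 / 100 := by nlinarith
    have h2 : π ^ 2 ≤ 10 := by nlinarith
    nlinarith [sq_nonneg ρ, sq_nonneg π]
  have s2 : π ^ 2 * ρ ^ 2 / 2 ≤ S := by
    have := (abs_le.1 s1).1
    have : π ^ 4 * ρ ^ 4 ≤ π ^ 2 * ρ ^ 2 / 2 := by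
      have : π ^ 4 * ρ ^ 4 = (π ^ 2 * ρ ^ 2) * (π ^ 2 * ρ ^ 2) := by ring
      rw [this]
      nlinarith [show 0 ≤ π ^ 2 * ρ ^ 2 by positivity]
    linarith
  have hSpos : 0 < S := lt_of_lt_of_le (by positivity) s2
  have e : N / S - t / ρ ^ 2 = (ρ ^ 2 * (N - π ^ 2 * t) - t * (S - π ^ 2 * ρ ^ 2)) / (S * ρ ^ 2) := by
    field_simp; ring
  rw [e, abs_div, abs_of_pos (show 0 < S * ρ ^ 2 by positivity), div_le_iff₀ (by positivity)]
  calc |ρ ^ 2 * (N - π ^ 2 * t) - t * (S - π ^ 2 * ρ ^ 2)|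
      ≤ |ρ ^ 2 * (N - π ^ 2 * t)| + |t * (S - π ^ 2 * ρ ^ 2)| := abs_sub _ _
    _ = ρ ^ 2 * |N - π ^ 2 * t| + |t| * |S - π ^ 2 * ρ ^ 2| := by
        rw [abs_mul, abs_mul, abs_of_pos (show 0 < ρ ^ 2 by positivity)]
    _ ≤ ρ ^ 2 * (π ^ 4 * ρ ^ 3) + ρ * (π ^ 4 * ρ ^ 4) := by gcongr
    _ = 4 * π ^ 2 * ρ * ((π ^ 2 * ρ ^ 2 / 2) * ρ ^ 2) := by ring
    _ ≤ _ := by gcongr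

lemma DD_sing (p z : Pl) (hz : SS p z = 0) (i : Fin 2) :
    Tendsto (fun x => DD p i x - (x i - z i) / dist x z ^ 2) (𝓝[≠] z) (𝓝 0) := by
  obtain ⟨v, hv, rfl⟩ := (SS_eq_zero_iff p z).1 hz
  have hper : ∀ x, DD p i x = π / 2 * Real.sin (2 * π * (x i - (p + v) i)) /
      (1 - (Real.cos (2 * π * (x 0 - (p + v) 0)) + Real.cos (2 * π * (x 1 - (p + v) 1))) / 2) := by
    intro x
    have h1 : DD p i (x - v) = DD p i x := by
      have := DD_periodic p (x - v) i hv
      rw [sub_add_cancel] at this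
      exact this.symm
    rw [← h1]
    unfold DD
    rw [SS_eq]
    simp only [PiLp.add_apply, PiLp.sub_apply]
    rw [show x i - v i - p i = x i - (p i + v i) by ring,
      show x 0 - v 0 - p 0 = x 0 - (p 0 + v 0) by ring,
      show x 1 - v 1 - p 1 = x 1 - (p 1 + v 1) by ring]
  set z := p + v
  have hlim : Tendsto (fun x => 4 * π ^ 2 * dist x z) (𝓝[≠] z) (𝓝 0) := by
    have : Continuous fun x => 4 * π ^ 2 * dist x z := by fun_prop
    have := this.tendsto z
    simp only [dist_self, mul_zero] at this
    exact this.mono_left nhdsWithin_le_nhds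
  refine squeeze_zero_norm' ?_ hlim
  have hball : ∀ᶠ x in 𝓝[≠] z, x ∈ ball z (1 / 10) :=
    nhdsWithin_le_nhds (ball_mem_nhds z (by norm_num))
  filter_upwards [hball, self_mem_nhdsWithin] with x hx hxz
  have hρ : 0 < dist x z := dist_pos.2 hxz
  rw [Real.norm_eq_abs, hper x]
  have hn := LocSol.normsq x z
  fin_cases i
  · exact DD_sing_bound hρ (mem_ball.1 hx).le hn
  · have := DD_sing_bound (t := x 1 - z 1) (s := x 0 - z 0) hρ (mem_ball.1 hx).le (by linarith)
    rw [add_comm (Real.cos (2 * π * (x 1 - z 1)))] at this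
    exact this


def EEc (c : Pl) (q : ℝ × ℝ) : Pl := c + EE q

def EEl : ℝ × ℝ →L[ℝ] Pl :=
  (ContinuousLinearMap.fst ℝ ℝ ℝ).smulRight (EuclideanSpace.single 0 (1:ℝ)) +
  (ContinuousLinearMap.snd ℝ ℝ ℝ).smulRight (EuclideanSpace.single 1 (1:ℝ))

lemma EEl_apply (q : ℝ × ℝ) : EEl q = EE q := by simp [EEl, EE]

lemma EEc_hasFDerivAt (c : Pl) (q : ℝ × ℝ) : HasFDerivAt (EEc c) EEl q := by
  have h : EEc c = fun q => c + EEl q := by funext q; rw [EEl_apply]; rfl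
  rw [h]
  exact (EEl.hasFDerivAt).const_add c

lemma EEc_cont (c : Pl) : Continuous (EEc c) := by
  unfold EEc; exact continuous_const.add EE_cont

lemma EEc_inj (c : Pl) : Function.Injective (EEc c) := by
  intro q r h
  unfold EEc at h
  have h := add_left_cancel h
  have h0 : EE q 0 = EE r 0 := by rw [h]
  have h1 : EE q 1 = EE r 1 := by rw [h]
  simp only [EE_zero_coord, EE_one_coord] at h0 h1
  exact Prod.ext h0 h1

def Box : Set (ℝ × ℝ) := Icc (-(1/2):ℝ) (1/2) ×ˢ Icc (-(1/2):ℝ) (1/2)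

lemma Box_compact : IsCompact Box := isCompact_Icc.prod isCompact_Icc

lemma pre_countable {Z : Set Pl} (hZ : Z.Countable) (c : Pl) : (EEc c ⁻¹' Z).Countable :=
  hZ.preimage_of_injOn (EEc_inj c).injOn

lemma pre_ae {Z : Set Pl} (hZ : Z.Countable) (c : Pl) : ∀ᵐ q : ℝ × ℝ, EEc c q ∉ Z := by
  have := (pre_countable hZ c).measure_zero (volume : Measure (ℝ × ℝ))
  exact measure_eq_zero_iff_ae_notMem.1 this

lemma integrable_box {Z : Set Pl} (hZ : Z.Countable) (hZc : IsClosed Z) {g : Pl → ℝ}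
    (hg : ContinuousOn g Zᶜ) (hb : ∀ z ∈ Z, ∃ C, ∀ᶠ x in 𝓝[Zᶜ] z, |g x| ≤ C) (c : Pl) :
    IntegrableOn (fun q => g (EEc c q)) Box := by
  have hopen : IsOpen (EEc c ⁻¹' Zᶜ) := hZc.isOpen_compl.preimage (EEc_cont c)
  have hmeas : AEStronglyMeasurable (fun q => g (EEc c q)) (volume : Measure (ℝ × ℝ)) := by
    have h1 : ContinuousOn (fun q => g (EEc c q)) (EEc c ⁻¹' Zᶜ) :=
      hg.comp (EEc_cont c).continuousOn (fun q hq => hq)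
    have h2 := h1.aestronglyMeasurable (μ := volume) hopen.measurableSet
    have h3 : ∀ᵐ q : ℝ × ℝ, q ∈ EEc c ⁻¹' Zᶜ := pre_ae hZ c
    rwa [Measure.restrict_eq_self_of_ae_mem h3] at h2
  have hbd : ∀ z, ∃ C, ∀ᶠ x in 𝓝[Zᶜ] z, |g x| ≤ C := by
    intro z
    by_cases hz : z ∈ Z
    · exact hb z hz
    · refine ⟨|g z| + 1, ?_⟩
      have := (hg z hz).abs.tendsto
      exact this.eventually_le_const (by linarith)
  have hcomp : IsCompact (EEc c '' Box) := Box_compact.image (EEc_cont c)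
  have : ∃ C, ∀ x ∈ EEc c '' Box, x ∉ Z → |g x| ≤ C := by
    refine hcomp.induction_on (p := fun s => ∃ C, ∀ x ∈ s, x ∉ Z → |g x| ≤ C) ⟨0, by simp⟩ ?_ ?_ ?_
    · rintro s t hst ⟨C, hC⟩
      exact ⟨C, fun x hx => hC x (hst hx)⟩
    · rintro s t ⟨C, hC⟩ ⟨C', hC'⟩
      refine ⟨max C C', fun x hx hxZ => ?_⟩
      rcases hx with hx | hx
      · exact (hC x hx hxZ).trans (le_max_left _ _)
      · exact (hC' x hx hxZ).trans (le_max_right _ _)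
    · intro x hx
      obtain ⟨C, hC⟩ := hbd x
      rw [eventually_nhdsWithin_iff] at hC
      exact ⟨{y | y ∈ Zᶜ → |g y| ≤ C}, mem_nhdsWithin_of_mem_nhds hC, C, fun y hy hyZ => hy hyZ⟩
  obtain ⟨C, hC⟩ := this
  refine Measure.integrableOn_of_bounded (M := C) Box_compact.measure_lt_top.ne hmeas ?_
  refine (ae_restrict_iff' Box_compact.isClosed.measurableSet).2 ?_
  filter_upwards [pre_ae hZ c] with q hq hqB
  exact hC _ (mem_image_of_mem _ hqB) hq

lemma single_mem (k : Fin 2) : EuclideanSpace.single k (1:ℝ) ∈ unitLattice := by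
  rw [lattice_coord]
  fin_cases k
  · exact ⟨1, 0, by simp, by simp⟩
  · exact ⟨0, 1, by simp, by simp⟩

lemma ext_periodic {Z : Set Pl} (hZ : Z.Countable) {Y Y' : Pl → ℝ} (hY : Periodic2 Y)
    (hc : Continuous Y') (he : ∀ x, x ∉ Z → Y' x = Y x) : Periodic2 Y' := by
  intro x v hv
  have hcount : (Z ∪ (fun x => x + v) ⁻¹' Z).Countable :=
    hZ.union (hZ.preimage_of_injOn (add_left_injective v).injOn)
  have hd := Set.Countable.dense_compl ℝ hcount
  have h1 : Continuous fun x => Y' (x + v) := hc.comp (continuous_id.add continuous_const)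
  have := Continuous.ext_on hd h1 hc (fun y hy => by
    simp only [mem_compl_iff, mem_union, mem_preimage, not_or] at hy
    rw [he _ hy.1, he _ hy.2, hY y v hv])
  exact congrFun this x

lemma torus_div {Z : Set Pl} (hZ : Z.Countable) (hZc : IsClosed Z) {Y : Fin 2 → Pl → ℝ}
    (hper : ∀ k, Periodic2 (Y k)) (hdiff : ∀ k, ∀ x ∉ Z, DifferentiableAt ℝ (Y k) x)
    (hlim : ∀ k, ∀ z ∈ Z, ∃ y, Tendsto (Y k) (𝓝[Zᶜ] z) (𝓝 y)) (c : Pl)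
    (hi : IntegrableOn (fun q => pd (Y 0) 0 (EEc c q) + pd (Y 1) 1 (EEc c q)) Box) :
    ∫ q in Box, (pd (Y 0) 0 (EEc c q) + pd (Y 1) 1 (EEc c q)) = 0 := by
  have hdense : Dense Zᶜ := Set.Countable.dense_compl ℝ hZ
  set Y' : Fin 2 → Pl → ℝ := fun k => extendFrom Zᶜ (Y k) with hY'
  have hcont : ∀ k, Continuous (Y' k) := by
    intro k
    refine continuous_extendFrom hdense fun x => ?_
    by_cases hx : x ∈ Z
    · exact hlim k x hx
    · exact ⟨Y k x, (hdiff k x hx).continuousAt.continuousWithinAt⟩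
  have hext : ∀ k, ∀ x ∉ Z, Y' k x = Y k x := by
    intro k x hx
    exact extendFrom_extends (fun x hx => (hdiff k x hx).continuousAt.continuousWithinAt) x hx
  have hper' : ∀ k, Periodic2 (Y' k) := fun k => ext_periodic hZ (hper k) (hcont k) (hext k)
  have hfd : ∀ k, ∀ q, EEc c q ∉ Z → HasFDerivAt (fun q => Y' k (EEc c q))
      ((fderiv ℝ (Y k) (EEc c q)).comp EEl) q := by
    intro k q hq
    have h1 : HasFDerivAt (Y' k) (fderiv ℝ (Y k) (EEc c q)) (EEc c q) := by
      refine (hdiff k _ hq).hasFDerivAt.congr_of_eventuallyEq ?_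
      filter_upwards [hZc.isOpen_compl.mem_nhds hq] with x hx
      exact hext k x hx
    exact h1.comp q (EEc_hasFDerivAt c q)
  have hu1 : uIcc (-(1/2):ℝ) (1/2) = Icc (-(1/2):ℝ) (1/2) := uIcc_of_le (by norm_num)
  have hval : ∀ k : Fin 2, ∀ q, EEc c q ∉ Z →
      pd (Y k) k (EEc c q) = fderiv ℝ (Y k) (EEc c q) (EuclideanSpace.single k (1:ℝ)) :=
    fun k q hq => pd_eq_fderiv (hdiff k _ hq) k
  have hae : (fun q => pd (Y 0) 0 (EEc c q) + pd (Y 1) 1 (EEc c q)) =ᵐ[volume.restrict Box]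
      (fun q => ((fderiv ℝ (Y 0) (EEc c q)).comp EEl) (1, 0) +
        ((fderiv ℝ (Y 1) (EEc c q)).comp EEl) (0, 1)) := by
    refine ae_restrict_of_ae ?_
    filter_upwards [pre_ae hZ c] with q hq
    rw [hval 0 q hq, hval 1 q hq]
    simp [EEl_apply, EE]
  have hi' := hi.congr_fun_ae hae
  have key := integral2_divergence_prod_of_hasFDerivAt_off_countable
    (fun q => Y' 0 (EEc c q)) (fun q => Y' 1 (EEc c q))
    (fun q => (fderiv ℝ (Y 0) (EEc c q)).comp EEl) (fun q => (fderiv ℝ (Y 1) (EEc c q)).comp EEl)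
    (-(1/2)) (-(1/2)) (1/2) (1/2) (EEc c ⁻¹' Z) (pre_countable hZ c)
    ((hcont 0).comp (EEc_cont c)).continuousOn ((hcont 1).comp (EEc_cont c)).continuousOn
    (fun q hq => hfd 0 q hq.2) (fun q hq => hfd 1 q hq.2) (by rw [hu1]; exact hi')
  rw [integral_congr_ae hae]
  have e1 : ∀ y : ℝ, Y' 0 (EEc c ((1/2:ℝ), y)) = Y' 0 (EEc c (-(1/2:ℝ), y)) := by
    intro y
    have : EEc c ((1/2:ℝ), y) = EEc c (-(1/2:ℝ), y) + EuclideanSpace.single 0 (1:ℝ) := by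
      apply pl_ext <;> simp [EEc] <;> ring
    rw [this, hper' 0 _ _ (single_mem 0)]
  have e2 : ∀ x : ℝ, Y' 1 (EEc c (x, (1/2:ℝ))) = Y' 1 (EEc c (x, -(1/2:ℝ))) := by
    intro x
    have : EEc c (x, (1/2:ℝ)) = EEc c (x, -(1/2:ℝ)) + EuclideanSpace.single 1 (1:ℝ) := by
      apply pl_ext <;> simp [EEc] <;> ring
    rw [this, hper' 1 _ _ (single_mem 1)]
  simp only [e1, e2] at key
  rw [show ∀ a b : ℝ, a - a + b - b = 0 by intros; ring] at key
  unfold Box at hi' ⊢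
  rw [Measure.volume_eq_prod, setIntegral_prod _ hi']
  refine Eq.trans ?_ key
  rw [intervalIntegral.integral_of_le (by norm_num), integral_Icc_eq_integral_Ioc]
  congr 1
  funext x
  rw [intervalIntegral.integral_of_le (by norm_num), integral_Icc_eq_integral_Ioc]

abbrev VI (V : VortexData) := Fin V.d₁ ⊕ Fin V.d₂
def Vp (V : VortexData) : VI V → Pl := Sum.elim V.p₁ V.p₂
def Va (V : VortexData) : VI V → ℝ := Sum.elim V.m₁ (fun j => -V.m₂ j)

/-- limit value of `hh ∘ u` at a singularity -/
def HV (a : ℝ) : ℝ := if 0 < a then hh (-1) else hh 1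

def Vc (V : VortexData) (i : VI V) : ℝ := -2 * Va V i * HV (Va V i)

lemma mem_Z_iff (V : VortexData) (x : Pl) : x ∈ V.Z ↔ ∃ i : VI V, SS (Vp V i) x = 0 := by
  simp only [SS_eq_zero_iff]
  unfold VortexData.Z VortexData.Z1 VortexData.Z2
  constructor
  · rintro (⟨j, v, hv, rfl⟩ | ⟨j, v, hv, rfl⟩)
    · exact ⟨Sum.inl j, v, hv, rfl⟩
    · exact ⟨Sum.inr j, v, hv, rfl⟩
  · rintro ⟨j | j, v, hv, rfl⟩
    · exact Or.inl ⟨j, v, hv, rfl⟩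
    · exact Or.inr ⟨j, v, hv, rfl⟩

lemma Z_closed (V : VortexData) : IsClosed V.Z := by
  have : V.Z = ⋃ i : VI V, {x | SS (Vp V i) x = 0} := by
    ext x; rw [mem_Z_iff, mem_iUnion]; rfl
  rw [this]
  exact isClosed_iUnion_of_finite fun i => isClosed_eq (SS_contDiff _).continuous continuous_const

lemma lattice_countable : unitLattice.Countable := by
  have : unitLattice = range (fun q : ℤ × ℤ => (q.1 : ℝ) • EuclideanSpace.single (0 : Fin 2) (1:ℝ) +
      (q.2 : ℝ) • EuclideanSpace.single (1 : Fin 2) (1:ℝ)) := by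
    ext v
    constructor
    · rintro ⟨a, b, h⟩; exact ⟨(a, b), h.symm⟩
    · rintro ⟨⟨a, b⟩, h⟩; exact ⟨a, b, h.symm⟩
  rw [this]
  exact countable_range _

lemma Z_countable (V : VortexData) : V.Z.Countable := by
  have : V.Z = ⋃ i : VI V, (fun v => Vp V i + v) '' unitLattice := by
    ext x; rw [mem_Z_iff, mem_iUnion]
    simp only [SS_eq_zero_iff]
    constructor
    · rintro ⟨i, v, hv, rfl⟩; exact ⟨i, v, hv, rfl⟩
    · rintro ⟨i, v, hv, rfl⟩; exact ⟨i, v, hv, rfl⟩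
  rw [this]
  exact countable_iUnion fun i => lattice_countable.image _

lemma SS_ne (V : VortexData) {i j : VI V} (hij : i ≠ j) {z : Pl} (hi : SS (Vp V i) z = 0) :
    SS (Vp V j) z ≠ 0 := by
  intro hj
  obtain ⟨v, hv, h1⟩ := (SS_eq_zero_iff _ _).1 hi
  obtain ⟨w, hw, h2⟩ := (SS_eq_zero_iff _ _).1 hj
  refine V.distinct i j hij (w - v) ?_ ?_
  · obtain ⟨a, b, h0, h1⟩ := lattice_coord.1 hv
    obtain ⟨a', b', h0', h1'⟩ := lattice_coord.1 hw
    exact lattice_coord.2 ⟨a' - a, b' - b, by simp [h0, h0'], by simp [h1, h1']⟩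
  · have : Vp V i + v = Vp V j + w := h1 ▸ h2
    change Vp V i = Vp V j + (w - v)
    rw [← add_sub_assoc, ← this]; simp

lemma neg_mem_lattice {v : Pl} (hv : v ∈ unitLattice) : -v ∈ unitLattice := by
  obtain ⟨a, b, h0, h1⟩ := lattice_coord.1 hv
  exact lattice_coord.2 ⟨-a, -b, by simp [h0], by simp [h1]⟩

lemma logSing_at {V : VortexData} {τ ε : ℝ} {u : Pl → ℝ} (hu : IsSolution V τ ε u) {z : Pl}
    {i : VI V} (hi : SS (Vp V i) z = 0) : LogSing u z (Va V i) := by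
  obtain ⟨v, hv, rfl⟩ := (SS_eq_zero_iff _ _).1 hi
  have h : LogSing u (Vp V i) (Va V i) := by
    rcases i with j | j
    · exact hu.sing₁ j
    · exact hu.sing₂ j
  obtain ⟨r, hr, w, hw, he⟩ := h
  refine ⟨r, hr, fun x => w (x - v), ?_, ?_⟩
  · refine hw.comp (contDiff_id.sub contDiff_const).contDiffOn ?_
    intro x hx
    simp only [mem_ball, id, dist_eq_norm] at hx ⊢
    rwa [show x - v - Vp V i = x - (Vp V i + v) by abel]
  · intro x hx hne
    have h1 := he (x - v) (by
      simp only [mem_ball, dist_eq_norm] at hx ⊢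
      rwa [show x - v - Vp V i = x - (Vp V i + v) by abel]) (by
      intro h; apply hne; rw [← h]; abel)
    rw [show x - v - Vp V i = x - (Vp V i + v) by abel] at h1
    rw [← h1]
    have := hu.periodic x (-v) (neg_mem_lattice hv)
    rw [← this, sub_eq_add_neg]

lemma pd_log {u v : Pl → ℝ} {z x : Pl} {r a : ℝ} (hv : ContDiffOn ℝ (⊤ : ℕ∞) v (ball z r))
    (he : ∀ x ∈ ball z r, x ≠ z → u x = 2 * a * Real.log ‖x - z‖ + v x)
    (hx : x ∈ ball z r) (hne : x ≠ z) (k : Fin 2) :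
    pd u k x = 2 * a * ((x k - z k) / dist x z ^ 2) + pd v k x := by
  have hd : 0 < dist x z := dist_pos.2 hne
  have hopen : IsOpen (ball z r ∩ {z}ᶜ) := isOpen_ball.inter isOpen_compl_singleton
  have hev : u =ᶠ[𝓝 x] fun y => a * Real.log ((y 0 - z 0) ^ 2 + (y 1 - z 1) ^ 2) + v y := by
    filter_upwards [hopen.mem_nhds ⟨hx, hne⟩] with y hy
    rw [he y hy.1 hy.2, LocSol.normsq, dist_eq_norm, Real.log_pow]
    push_cast; ring
  rw [pd_congr hev k]
  have hN := LocSol.normsq x z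
  have hN0 : (x 0 - z 0) ^ 2 + (x 1 - z 1) ^ 2 ≠ 0 := by rw [hN]; positivity
  have hvd : DifferentiableAt ℝ v x := diffAt_of isOpen_ball hv hx
  have hL : DifferentiableAt ℝ (fun y : Pl => Real.log ((y 0 - z 0) ^ 2 + (y 1 - z 1) ^ 2)) x := by
    refine DifferentiableAt.log ?_ hN0
    fun_prop
  rw [pd_lin a hL hvd]
  have : pd (fun y : Pl => Real.log ((y 0 - z 0) ^ 2 + (y 1 - z 1) ^ 2)) k x
      = 2 * (x k - z k) / dist x z ^ 2 := by
    apply pd_of_hasDerivAt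
    rw [← hN]
    fin_cases k
    · have h1 : HasDerivAt (fun t : ℝ => (x 0 + t - z 0) ^ 2 + (x 1 - z 1) ^ 2) (2 * (x 0 - z 0)) 0 := by
        have := ((((hasDerivAt_id (0:ℝ)).const_add (x 0)).sub_const (z 0)).pow 2).add_const ((x 1 - z 1) ^ 2)
        exact this.congr_deriv (by simp)
      have h2 := h1.log (by simpa using hN0)
      simpa using h2
    · have h1 : HasDerivAt (fun t : ℝ => (x 0 - z 0) ^ 2 + (x 1 + t - z 1) ^ 2) (2 * (x 1 - z 1)) 0 := by
        have := ((((hasDerivAt_id (0:ℝ)).const_add (x 1)).sub_const (z 1)).pow 2).const_add ((x 0 - z 0) ^ 2)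
        exact this.congr_deriv (by simp)
      have h2 := h1.log (by simpa using hN0)
      simpa using h2
  rw [this]; ring

lemma log_local {u : Pl → ℝ} {z : Pl} {a : ℝ} (h : LogSing u z a) :
    (∀ k : Fin 2, ∃ y, Tendsto (fun x => hh (u x) * pd u k x
      - 2 * a * HV a * ((x k - z k) / dist x z ^ 2)) (𝓝[≠] z) (𝓝 y)) ∧
    ∃ C, ∀ᶠ x in 𝓝[≠] z, |hd (u x) * gradSq u x| ≤ C := by
  obtain ⟨r, hr, v, hv, he⟩ := h
  have hball : ball z r ∈ 𝓝 z := ball_mem_nhds z hr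
  have hpv : ∀ k, ContinuousAt (pd v k) z := fun k =>
    (pd_contDiffOn isOpen_ball hv k).continuousOn.continuousAt hball
  have hvc : ContinuousAt v z := hv.continuousOn.continuousAt hball
  have hev : ∀ᶠ x in 𝓝[≠] z, u x = 2 * a * Real.log ‖x - z‖ + v x ∧
      ∀ k, pd u k x = 2 * a * ((x k - z k) / dist x z ^ 2) + pd v k x := by
    rw [eventually_nhdsWithin_iff]
    filter_upwards [hball] with x hx hne
    exact ⟨he x hx hne, fun k => pd_log hv he hx hne k⟩
  have hlog : Tendsto (fun x : Pl => Real.log ‖x - z‖) (𝓝[≠] z) atBot := by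
    refine Real.tendsto_log_nhdsGT_zero.comp ?_
    rw [tendsto_nhdsWithin_iff]
    constructor
    · have : Continuous fun x : Pl => ‖x - z‖ := by fun_prop
      have h2 := this.tendsto z
      simp only [sub_self, norm_zero] at h2
      exact h2.mono_left nhdsWithin_le_nhds
    · filter_upwards [self_mem_nhdsWithin] with x hx
      exact norm_pos_iff.2 (sub_ne_zero.2 hx)
  have hvw : Tendsto v (𝓝[≠] z) (𝓝 (v z)) := hvc.tendsto.mono_left nhdsWithin_le_nhds
  have hpw : ∀ k, Tendsto (pd v k) (𝓝[≠] z) (𝓝 (pd v k z)) :=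
    fun k => (hpv k).tendsto.mono_left nhdsWithin_le_nhds
  by_cases ha : a = 0
  · subst ha
    constructor
    · intro k
      refine ⟨hh (v z) * pd v k z, ?_⟩
      refine Tendsto.congr' ?_ (((hh_cont.tendsto _).comp hvw).mul (hpw k))
      filter_upwards [hev] with x hx
      rw [hx.1, hx.2 k]; simp
    · refine ⟨|hd (v z) * (pd v 0 z ^ 2 + pd v 1 z ^ 2)| + 1, ?_⟩
      have := (((hd_cont.tendsto _).comp hvw).mul (((hpw 0).pow 2).add ((hpw 1).pow 2))).abs
      filter_upwards [hev, this.eventually_le_const (lt_add_one _)] with x hx h2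
      unfold gradSq
      rw [hx.1, hx.2 0, hx.2 1]; simpa using h2
  · have key : ∀ᶠ x in 𝓝[≠] z, 1 ≤ |u x| ∧ hh (u x) = HV a := by
      rcases lt_or_gt_of_ne ha with h | h
      · have : Tendsto (fun x => 2 * a * Real.log ‖x - z‖ + v x) (𝓝[≠] z) atTop :=
          (hlog.const_mul_atBot_of_neg (by linarith)).atTop_add hvw
        filter_upwards [hev, this.eventually_ge_atTop 1] with x hx h2
        rw [← hx.1] at h2
        refine ⟨h2.trans (le_abs_self _), ?_⟩
        rw [HV, if_neg (by linarith), hh_ge h2]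
      · have : Tendsto (fun x => 2 * a * Real.log ‖x - z‖ + v x) (𝓝[≠] z) atBot :=
          (hlog.const_mul_atBot (by linarith)).atBot_add hvw
        filter_upwards [hev, this.eventually_le_atBot (-1)] with x hx h2
        rw [← hx.1] at h2
        refine ⟨by rw [abs_of_neg (by linarith)]; linarith, ?_⟩
        rw [HV, if_pos h, hh_le h2]
    constructor
    · intro k
      refine ⟨HV a * pd v k z, ?_⟩
      refine Tendsto.congr' ?_ ((hpw k).const_mul (HV a))
      filter_upwards [hev, key] with x hx h2
      rw [h2.2, hx.2 k]; ring
    · refine ⟨0, ?_⟩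
      filter_upwards [key] with x hx
      rw [hd_zero hx.1]; simp

def GG (τ ε : ℝ) (u : Pl → ℝ) (x : Pl) : ℝ :=
  hd (u x) * gradSq u x + (ε ^ 2)⁻¹ * (-(fτ τ (u x) * hh (u x)))

def YY (V : VortexData) (u : Pl → ℝ) (k : Fin 2) (x : Pl) : ℝ :=
  hh (u x) * pd u k x + ∑ j, Vc V j * DD (Vp V j) k x

lemma ftau_bdd {τ : ℝ} (hτ : 0 < τ) (t : ℝ) : |fτ τ t| ≤ τ⁻¹ * (1 + τ⁻¹) := by
  unfold fτ
  have h1 := Real.exp_pos t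
  set E := Real.exp t
  set k := τ⁻¹ with hk
  have hk0 : 0 < k := inv_pos.2 hτ
  have hkτ : k * τ = 1 := inv_mul_cancel₀ hτ.ne'
  rw [abs_div, abs_of_pos (show 0 < (τ + E) ^ 3 by positivity), div_le_iff₀ (by positivity),
    abs_mul, abs_of_pos h1]
  have h2 : |1 - E| ≤ 1 + E := by rw [abs_le]; constructor <;> linarith
  have h3 : k * (1 + k) * (τ + E) ^ 3 = (k * τ) * τ ^ 2 + (k * τ) ^ 2 * τ + 3 * (k * τ) * τ * E
      + 3 * (k * τ) ^ 2 * E + 3 * (k * τ) * E ^ 2 + 3 * k * (k * τ) * E ^ 2 + k * (1 + k) * E ^ 3 := by ring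
  rw [h3, hkτ]
  have : E * |1 - E| ≤ E * (1 + E) := mul_le_mul_of_nonneg_left h2 h1.le
  have : 0 ≤ 1 * τ ^ 2 + 1 ^ 2 * τ + 3 * 1 * τ * E + 3 * k * 1 * E ^ 2 + k * (1 + k) * E ^ 3 := by positivity
  nlinarith [sq_nonneg E]

lemma hasDerivAt_line {φ : Pl → ℝ} {x : Pl} (h : DifferentiableAt ℝ φ x) (k : Fin 2) :
    HasDerivAt (fun t : ℝ => φ (x + t • EuclideanSpace.single k (1:ℝ))) (pd φ k x) 0 := by
  rw [pd_eq_fderiv h]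
  exact h.hasFDerivAt.hasLineDerivAt _

section
variable {V : VortexData} {τ ε : ℝ} {u : Pl → ℝ}

lemma YY_diff (hu : IsSolution V τ ε u) {x : Pl} (hx : x ∉ V.Z) (k : Fin 2) :
    DifferentiableAt ℝ (YY V u k) x := by
  have hO := (Z_closed V).isOpen_compl
  have h1 := diffAt_of hO hu.smooth hx
  have h2 := diffAt_of hO (pd_contDiffOn hO hu.smooth k) hx
  have h3 : ∀ j : VI V, DifferentiableAt ℝ (DD (Vp V j) k) x := fun j =>
    (DD_contDiffAt (fun h => hx ((mem_Z_iff V x).2 ⟨j, h⟩)) k).differentiableAt (by simp)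
  unfold YY
  refine DifferentiableAt.add (DifferentiableAt.mul ?_ h2) ?_
  · exact (hh_deriv (u x)).differentiableAt.comp x h1
  · exact DifferentiableAt.fun_sum fun j _ => (h3 j).const_mul _

lemma pd_YY (hu : IsSolution V τ ε u) {x : Pl} (hx : x ∉ V.Z) (k : Fin 2) :
    pd (YY V u k) k x = hd (u x) * pd u k x ^ 2 + hh (u x) * pd (pd u k) k x +
      ∑ j, Vc V j * pd (DD (Vp V j) k) k x := by
  have hO := (Z_closed V).isOpen_compl
  have h1 := hasDerivAt_line (diffAt_of hO hu.smooth hx) k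
  have h2 := hasDerivAt_line (diffAt_of hO (pd_contDiffOn hO hu.smooth k) hx) k
  have h3 : ∀ j : VI V, _ := fun j =>
    hasDerivAt_line ((DD_contDiffAt (p := Vp V j) (fun h => hx ((mem_Z_iff V x).2 ⟨j, h⟩)) k).differentiableAt (by simp)) k
  apply pd_of_hasDerivAt
  have h4 : HasDerivAt (fun t : ℝ => hh (u (x + t • EuclideanSpace.single k (1:ℝ))))
      (hd (u x) * pd u k x) 0 := by
    have := HasDerivAt.comp (0:ℝ) (h := fun t : ℝ => u (x + t • EuclideanSpace.single k (1:ℝ)))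
      (hh_deriv _) h1
    exact this.congr_deriv (by simp)
  have h5 := (h4.mul h2).add (HasDerivAt.fun_sum (u := Finset.univ) fun j _ => (h3 j).const_mul (Vc V j))
  refine h5.congr_deriv ?_
  simp; ring

lemma div_YY (hu : IsSolution V τ ε u) {x : Pl} (hx : x ∉ V.Z) :
    pd (YY V u 0) 0 x + pd (YY V u 1) 1 x = GG τ ε u x +
      ∑ j, Vc V j * (pd (DD (Vp V j) 0) 0 x + pd (DD (Vp V j) 1) 1 x) := by
  rw [pd_YY hu hx, pd_YY hu hx]
  simp only [mul_add, Finset.sum_add_distrib]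
  have h := hu.pde x hx
  unfold GG gradSq
  unfold lap at h
  have : (ε ^ 2)⁻¹ * (-(fτ τ (u x) * hh (u x))) = hh (u x) * (pd (pd u 0) 0 x + pd (pd u 1) 1 x) := by
    linear_combination -hh (u x) * h
  rw [this]; ring

lemma GG_cont (hτ : 0 < τ) (hu : IsSolution V τ ε u) : ContinuousOn (GG τ ε u) (V.Z)ᶜ := by
  have hO := (Z_closed V).isOpen_compl
  have h1 := hu.smooth.continuousOn
  have h2 := fun k => (pd_contDiffOn hO hu.smooth k).continuousOn
  unfold GG gradSq
  exact ((hd_cont.comp_continuousOn h1).mul (((h2 0).pow 2).add ((h2 1).pow 2))).add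
    (continuousOn_const.mul (((ftau_cont hτ).comp_continuousOn h1).mul (hh_cont.comp_continuousOn h1)).neg)

lemma DDdiv_cont : ContinuousOn (fun x => ∑ j, Vc V j * (pd (DD (Vp V j) 0) 0 x + pd (DD (Vp V j) 1) 1 x))
    (V.Z)ᶜ := by
  have hO := (Z_closed V).isOpen_compl
  have h : ∀ j : VI V, ∀ k, ContinuousOn (pd (DD (Vp V j) k) k) (V.Z)ᶜ := fun j k =>
    (pd_contDiffOn hO (fun x hx => (DD_contDiffAt (fun h => hx ((mem_Z_iff V x).2 ⟨j, h⟩)) k).contDiffWithinAt) k).continuousOn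
  exact continuousOn_finsetSum _ fun j _ => continuousOn_const.mul ((h j 0).add (h j 1))

def M1 (V : VortexData) : ℝ := ∑ j, |Vc V j| * (2 * π ^ 2)

lemma M1_nonneg (V : VortexData) : 0 ≤ M1 V := Finset.sum_nonneg fun j _ => by positivity

lemma DDdiv_bound {x : Pl} (hx : x ∉ V.Z) :
    |∑ j, Vc V j * (pd (DD (Vp V j) 0) 0 x + pd (DD (Vp V j) 1) 1 x)| ≤ M1 V := by
  refine (Finset.abs_sum_le_sum_abs _ _).trans (Finset.sum_le_sum fun j _ => ?_)
  rw [abs_mul]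
  exact mul_le_mul_of_nonneg_left (div_DD _ _ (fun h => hx ((mem_Z_iff V x).2 ⟨j, h⟩))) (abs_nonneg _)

lemma GG_bdd (hτ : 0 < τ) (hu : IsSolution V τ ε u) {z : Pl} (hz : z ∈ V.Z) :
    ∃ C, ∀ᶠ x in 𝓝[(V.Z)ᶜ] z, |GG τ ε u x| ≤ C := by
  obtain ⟨i, hi⟩ := (mem_Z_iff V z).1 hz
  obtain ⟨C, hC⟩ := (log_local (logSing_at hu hi)).2
  have hle : 𝓝[(V.Z)ᶜ] z ≤ 𝓝[≠] z := nhdsWithin_mono z fun x hx h => hx (by rw [h]; exact hz)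
  refine ⟨C + (ε ^ 2)⁻¹ * (τ⁻¹ * (1 + τ⁻¹) * (|hh 1| + |hh (-1)|)), ?_⟩
  filter_upwards [hle hC] with x hx
  unfold GG
  refine (abs_add_le _ _).trans (add_le_add hx ?_)
  rw [abs_mul, abs_neg, abs_mul, abs_of_nonneg (by positivity : 0 ≤ (ε ^ 2)⁻¹)]
  have := inv_pos.2 hτ
  gcongr
  · exact ftau_bdd hτ _
  · exact hh_bound _

lemma YY_lim (hu : IsSolution V τ ε u) {z : Pl} (hz : z ∈ V.Z) (k : Fin 2) :
    ∃ y, Tendsto (YY V u k) (𝓝[(V.Z)ᶜ] z) (𝓝 y) := by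
  obtain ⟨i, hi⟩ := (mem_Z_iff V z).1 hz
  obtain ⟨y, hy⟩ := (log_local (logSing_at hu hi)).1 k
  have hle : 𝓝[(V.Z)ᶜ] z ≤ 𝓝[≠] z := nhdsWithin_mono z fun x hx h => hx (by rw [h]; exact hz)
  have hj : ∀ j : VI V, ∃ l, Tendsto (fun x => Vc V j * DD (Vp V j) k x -
      (if j = i then Vc V j * ((x k - z k) / dist x z ^ 2) else 0)) (𝓝[≠] z) (𝓝 l) := by
    intro j
    by_cases h : j = i
    · subst h
      refine ⟨Vc V j * 0, ((DD_sing _ z hi k).const_mul (Vc V j)).congr fun x => ?_⟩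
      rw [if_pos rfl]; ring
    · refine ⟨Vc V j * DD (Vp V j) k z, ?_⟩
      simp only [if_neg h, sub_zero]
      have := (DD_contDiffAt (SS_ne V (Ne.symm h) hi) k).continuousAt.tendsto
      exact (this.mono_left nhdsWithin_le_nhds).const_mul _
  choose l hl using hj
  refine ⟨y + ∑ j, l j, ?_⟩
  refine Tendsto.mono_left ?_ hle
  refine (hy.add (tendsto_finsetSum Finset.univ fun j _ => hl j)).congr fun x => ?_
  unfold YY
  rw [Finset.sum_sub_distrib, Finset.sum_ite_eq' Finset.univ i]
  simp only [Finset.mem_univ, if_true, Vc]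
  ring

lemma pd_periodic (hu : Periodic2 u) (k : Fin 2) : Periodic2 (pd u k) := by
  intro x v hv
  unfold pd lineDeriv
  congr 1
  funext t
  rw [add_right_comm, hu _ v hv]

lemma YY_periodic (hu : Periodic2 u) (k : Fin 2) : Periodic2 (YY V u k) := by
  intro x v hv
  unfold YY
  rw [hu x v hv, pd_periodic hu k x v hv]
  simp only [DD_periodic _ x k hv]

lemma GG_nonneg (hτ : 0 < τ) (x : Pl) : 0 ≤ GG τ ε u x := by
  unfold GG gradSq
  have := hd_nonneg (u x)
  have := fh_nonneg hτ (u x)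
  positivity

lemma GG_integrable (hτ : 0 < τ) (hu : IsSolution V τ ε u) (c : Pl) :
    IntegrableOn (fun q => GG τ ε u (EEc c q)) Box :=
  integrable_box (Z_countable V) (Z_closed V) (GG_cont hτ hu) (fun z hz => GG_bdd hτ hu hz) c

lemma box_volume : volume.real Box = 1 := by
  unfold Box
  rw [Measure.volume_eq_prod, measureReal_prod_prod]
  simp [Real.volume_real_Icc]
  norm_num

/-- the energy bound -/
lemma energy (hτ : 0 < τ) (hu : IsSolution V τ ε u) (c : Pl) :
    ∫ q in Box, GG τ ε u (EEc c q) ≤ M1 V := by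
  have hG := GG_integrable hτ hu c
  have hD : IntegrableOn (fun q => pd (YY V u 0) 0 (EEc c q) + pd (YY V u 1) 1 (EEc c q)) Box := by
    refine integrable_box (g := fun x => pd (YY V u 0) 0 x + pd (YY V u 1) 1 x)
      (Z_countable V) (Z_closed V) ?_ ?_ c
    · exact ((GG_cont hτ hu).add DDdiv_cont).congr fun x hx => div_YY hu hx
    · intro z hz
      obtain ⟨C, hC⟩ := GG_bdd hτ hu hz
      refine ⟨C + M1 V, ?_⟩
      filter_upwards [hC, self_mem_nhdsWithin] with x hx hxZ
      rw [div_YY hu hxZ]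
      exact (abs_add_le _ _).trans (add_le_add hx (DDdiv_bound hxZ))
  have h0 := torus_div (Z_countable V) (Z_closed V) (YY_periodic hu.periodic)
    (fun k x hx => YY_diff hu hx k) (fun k z hz => YY_lim hu hz k) c hD
  have hconst : IntegrableOn (fun _ : ℝ × ℝ => M1 V) Box :=
    integrableOn_const Box_compact.measure_lt_top.ne
  have h1 : ∫ q in Box, GG τ ε u (EEc c q) ≤
      ∫ q in Box, ((pd (YY V u 0) 0 (EEc c q) + pd (YY V u 1) 1 (EEc c q)) + M1 V) := by
    refine integral_mono_ae hG (hD.add hconst) ?_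
    refine ae_restrict_of_ae ?_
    filter_upwards [pre_ae (Z_countable V) c] with q hq
    rw [div_YY hu hq]
    have := (abs_le.1 (DDdiv_bound hq)).1
    linarith
  rw [integral_add hD hconst, h0, setIntegral_const, box_volume] at h1
  simpa using h1

end

def kap (τ δ : ℝ) : ℝ := min (Pw τ δ - Pw τ (δ / 2)) (Pw τ (-(δ / 2)) - Pw τ (-δ))

lemma kap_pos {τ δ : ℝ} (hτ : 0 < τ) (hδ : 0 < δ) (hδ1 : δ ≤ 1) : 0 < kap τ δ := by
  refine lt_min (sub_pos.2 (Pw_lt hτ (by linarith) fun t ht => ?_))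
    (sub_pos.2 (Pw_lt hτ (by linarith) fun t ht => ?_))
  · have h1 := ht.1
    have h2 := ht.2
    exact ⟨by rw [abs_lt]; constructor <;> linarith, by linarith⟩
  · have h1 := ht.1
    have h2 := ht.2
    exact ⟨by rw [abs_lt]; constructor <;> linarith, by linarith⟩

section
variable {V : VortexData} {τ ε : ℝ} {u : Pl → ℝ}

lemma cost (hτ : 0 < τ) (hε : 0 < ε) (hu : IsSolution V τ ε u) {δ s₁ s₂ : ℝ} (hδ : 0 < δ)
    (hδ1 : δ ≤ 1) {c : Pl} (hs : 0 < s₁) (hs12 : s₁ ≤ s₂) (hs2 : s₂ ≤ 1 / 2)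
    (hD : closedBall c s₂ ⊆ (V.Z)ᶜ)
    (h1 : ∀ s ∈ Icc s₁ s₂, ∃ y ∈ sphere c s, |u y| ≤ δ / 2)
    (h2 : ∀ s ∈ Icc s₁ s₂, ∃ y ∈ sphere c s, δ ≤ |u y|) :
    kap τ δ * (s₂ - s₁) ≤ ε / 2 * M1 V := by
  have hO := (Z_closed V).isOpen_compl
  have hA := annulus_lower hO hu.smooth (P := Pw τ) (p := pw τ) (Pw_deriv hτ) (pw_cont hτ)
    (pw_nonneg τ) hs hs12 hD (kap_pos hτ hδ hδ1).le (by
      intro s hs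
      obtain ⟨y, hy, hy1⟩ := h1 s hs
      obtain ⟨z, hz, hz1⟩ := h2 s hs
      obtain ⟨hy2, hy3⟩ := abs_le.1 hy1
      rcases le_abs.1 hz1 with h | h
      · refine ⟨z, hz, y, hy, (min_le_left _ _).trans ?_⟩
        have := Pw_mono hτ h
        have := Pw_mono hτ hy3
        linarith
      · refine ⟨y, hy, z, hz, (min_le_right _ _).trans ?_⟩
        have := Pw_mono hτ (show u z ≤ -δ by linarith)
        have := Pw_mono hτ hy2
        linarith)
  refine hA.trans ?_
  have hsub : {q : ℝ × ℝ | q.1 ^ 2 + q.2 ^ 2 ≤ s₂ ^ 2} ⊆ Box := by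
    rintro ⟨x, y⟩ h
    change x ^ 2 + y ^ 2 ≤ s₂ ^ 2 at h
    have hs0 : 0 ≤ s₂ := hs.le.trans hs12
    have hx := abs_le_of_sq_le_sq' (show x ^ 2 ≤ s₂ ^ 2 by nlinarith [sq_nonneg y]) hs0
    have hy := abs_le_of_sq_le_sq' (show y ^ 2 ≤ s₂ ^ 2 by nlinarith [sq_nonneg x]) hs0
    exact ⟨⟨by linarith [hx.1], by linarith [hx.2]⟩, ⟨by linarith [hy.1], by linarith [hy.2]⟩⟩
  have hG := GG_integrable hτ hu c
  have hG2 : IntegrableOn (fun q => ε / 2 * GG τ ε u (EEc c q)) Box := hG.const_mul _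
  have step1 : ∫ q in {q : ℝ × ℝ | q.1 ^ 2 + q.2 ^ 2 ≤ s₂ ^ 2},
      pw τ (u (c + EE q)) * √(gradSq u (c + EE q)) ≤
      ∫ q in {q : ℝ × ℝ | q.1 ^ 2 + q.2 ^ 2 ≤ s₂ ^ 2}, ε / 2 * GG τ ε u (EEc c q) := by
    refine integral_mono_of_nonneg (Eventually.of_forall fun q => ?_) (hG2.mono_set hsub)
      (Eventually.of_forall fun q => ?_)
    · exact mul_nonneg (pw_nonneg _ _) (Real.sqrt_nonneg _)
    · exact pw_amgm hτ hε _ _ (by unfold gradSq; positivity)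
  have step2 : ∫ q in {q : ℝ × ℝ | q.1 ^ 2 + q.2 ^ 2 ≤ s₂ ^ 2}, ε / 2 * GG τ ε u (EEc c q) ≤
      ∫ q in Box, ε / 2 * GG τ ε u (EEc c q) := by
    refine setIntegral_mono_set hG2 (Eventually.of_forall fun q => ?_) hsub.eventuallyLE
    exact mul_nonneg (by linarith) (GG_nonneg hτ _)
  refine step1.trans (step2.trans ?_)
  rw [integral_const_mul]
  exact mul_le_mul_of_nonneg_left (energy hτ hu c) (by linarith)

lemma core (hτ : 0 < τ) (hε : 0 < ε) (hu : IsSolution V τ ε u) {δ α A R k₁ r₀ : ℝ} (hδ : 0 < δ)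
    (hδ1 : δ ≤ 1) (hα : 0 < α) (hf : ∀ t : ℝ, |t| ≤ 1 → α * |t| ≤ |fτ τ t|) (hA : 0 < A)
    (hf2 : ∀ t : ℝ, |fτ τ t| ≤ A * |t|) (hR : 0 < R) (hRα : 32 ≤ α * R ^ 2) (hk₁ : 0 < k₁)
    (hk : M1 V / 2 < kap τ δ * k₁) (hr : (R + k₁ + k₁) * ε ≤ r₀) (hr4 : r₀ ≤ 1 / 4)
    {a : Pl} (ha : closedBall a (2 * r₀) ⊆ (V.Z)ᶜ)
    (h1 : |u a| < δ / 2 * Real.exp (-(Real.sqrt A * (R + k₁ + k₁))))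
    (h2 : 4 * δ * ε ^ 2 / (α * r₀ ^ 2) < |u a|) : False := by
  have H : LocSol τ ε u (V.Z)ᶜ := ⟨hτ, hε, (Z_closed V).isOpen_compl, hu.smooth, fun x hx => hu.pde x hx⟩
  have hk1ε : 0 < k₁ * ε := by positivity
  have hRε : 0 < R * ε := by positivity
  have hr0 : 0 < r₀ := lt_of_lt_of_le (by positivity) hr
  have hcost : ε / 2 * M1 V < kap τ δ * (k₁ * ε) := by nlinarith
  have hsub : ∀ s ≤ r₀, closedBall a s ⊆ (V.Z)ᶜ := fun s hs =>
    (closedBall_subset_closedBall (by linarith)).trans ha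
  -- step 2
  have step2 : ∃ s, (R + k₁) * ε ≤ s ∧ s ≤ r₀ ∧ ∀ x ∈ closedBall a s, |u x| < δ := by
    by_contra hcon
    push Not at hcon
    have := cost hτ hε hu hδ hδ1 (c := a) (s₁ := (R + k₁) * ε) (s₂ := (R + k₁ + k₁) * ε)
      (by positivity) (by nlinarith) (by linarith) (hsub _ hr) (by
        intro s hs
        by_contra hc
        push Not at hc
        have h3 := H.harnack (hsub s (hs.2.trans hr)) hA hf2
          (lt_of_lt_of_le (by positivity) hs.1) (by positivity : 0 < δ / 2) hc
        have h4 : Real.sqrt A * s / ε ≤ Real.sqrt A * (R + k₁ + k₁) := by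
          rw [div_le_iff₀ hε, mul_assoc]
          exact mul_le_mul_of_nonneg_left hs.2 (Real.sqrt_nonneg _)
        have h5 : Real.exp (-(Real.sqrt A * (R + k₁ + k₁))) ≤ Real.exp (-(Real.sqrt A * s / ε)) :=
          Real.exp_le_exp.2 (by linarith)
        have h6 := mul_le_mul_of_nonneg_left h5 (by positivity : 0 ≤ δ / 2)
        linarith) (by
        intro s hs
        obtain ⟨x, hx, hx2⟩ := hcon s hs.1 (hs.2.trans hr)
        exact H.maxPrinciple (hsub s (hs.2.trans hr)) hδ hx hx2)
    have e : (R + k₁ + k₁) * ε - (R + k₁) * ε = k₁ * ε := by ring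
    rw [e] at this
    linarith
  obtain ⟨s, hs1, hs2, hs3⟩ := step2
  -- step 3
  have hcont : ContinuousOn (fun x => |u x|) (closedBall a r₀) :=
    (hu.smooth.continuousOn.mono (hsub r₀ le_rfl)).abs
  set S := closedBall a r₀ ∩ (fun x => |u x|) ⁻¹' (Ici δ) with hS
  have hScl : IsClosed S := hcont.preimage_isClosed_of_isClosed isClosed_closedBall isClosed_Ici
  have hScomp : IsCompact S := (isCompact_closedBall a r₀).of_isClosed_subset hScl inter_subset_left
  have hSne : S.Nonempty := by
    by_contra hne
    rw [not_nonempty_iff_eq_empty] at hne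
    have := H.decay (hsub r₀ le_rfl) hα hf hr0 hδ hδ1 (fun y hy => by
      by_contra hc
      push Not at hc
      have : y ∈ S := ⟨hy, hc.le⟩
      rw [hne] at this
      exact this)
    linarith
  obtain ⟨y, hyS, hymin⟩ := hScomp.exists_isMinOn hSne
    (f := fun x => dist x a) (by fun_prop)
  set ρ := dist y a with hρ
  have hρs : s < ρ := by
    by_contra hc
    push Not at hc
    have h3 := hs3 y hc
    have h4 : δ ≤ |u y| := hyS.2
    linarith
  have hρr : ρ ≤ r₀ := hyS.1
  have hin : ∀ x ∈ ball a ρ, |u x| < δ := by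
    intro x hx
    by_contra hc
    push Not at hc
    have hxS : x ∈ S := ⟨(mem_ball.1 hx).le.trans hρr, hc⟩
    have h3 : ρ ≤ dist x a := hymin hxS
    exact absurd (mem_ball.1 hx) (not_lt.2 h3)
  -- step 4
  have hsuby : ∀ t ≤ (R + k₁) * ε, closedBall y t ⊆ (V.Z)ᶜ := by
    intro t ht
    refine (closedBall_subset_closedBall' ?_).trans ha
    linarith
  have hρ0 : 0 < ρ := lt_of_lt_of_le (by positivity) (hs1.trans hρs.le)
  have := cost hτ hε hu hδ hδ1 (c := y) (s₁ := R * ε) (s₂ := (R + k₁) * ε)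
    hRε (by nlinarith) (by linarith) (hsuby _ le_rfl) (by
      intro t ht
      have ht0 : 0 < t := hRε.trans_le ht.1
      have htρ : t < ρ := ht.2.trans_lt (hs1.trans_lt hρs)
      refine ⟨AffineMap.lineMap y a (t / ρ), ?_, ?_⟩
      · rw [mem_sphere, dist_lineMap_left, Real.norm_of_nonneg (by positivity), ← hρ]
        field_simp
      · set z : Pl := AffineMap.lineMap y a (t / ρ) with hz
        have hza : dist z a = ρ - t := by
          rw [hz, dist_lineMap_right, Real.norm_of_nonneg (by
            rw [sub_nonneg, div_le_one hρ0]; exact htρ.le), ← hρ]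
          field_simp
        have hzb : closedBall z (t / 2) ⊆ ball a ρ := by
          intro x hx
          have h3 := dist_triangle x z a
          have h4 := mem_closedBall.1 hx
          rw [mem_ball]; linarith
        have h3 := H.decay (hzb.trans (ball_subset_closedBall.trans (hsub ρ hρr))) hα hf
          (half_pos ht0) hδ hδ1 (fun x hx => (hin x (hzb hx)).le)
        refine h3.trans ?_
        rw [div_le_iff₀ (by positivity)]
        have h5 : 32 * ε ^ 2 ≤ α * t ^ 2 := by
          have h6 : (R * ε) ^ 2 ≤ t ^ 2 := by
            apply pow_le_pow_left₀ hRε.le ht.1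
          have h7 : α * (R * ε) ^ 2 ≤ α * t ^ 2 := mul_le_mul_of_nonneg_left h6 hα.le
          have h8 : 32 * ε ^ 2 ≤ α * R ^ 2 * ε ^ 2 := mul_le_mul_of_nonneg_right hRα (by positivity)
          nlinarith
        nlinarith) (by
      intro t ht
      have ht0 : 0 < t := hRε.trans_le ht.1
      exact H.maxPrinciple (hsuby t ht.2) hδ (mem_closedBall_self ht0.le) hyS.2)
  have e : (R + k₁) * ε - R * ε = k₁ * ε := by ring
  rw [e] at this
  linarith

end
/-- **Lemma 3.4.** Let `K ⊆ Ω ∖ Z` be a connected compact set and `u_ε`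
a sequence of solutions of `(E_ε)` with `inf_K |u_ε| → 0` as `ε → 0`. Then
`‖u_ε‖_{L^∞(K)} → 0`. -/
theorem uniform_smallness
    (V : VortexData) (τ : ℝ) (hτ : 0 < τ)
    (ε : ℕ → ℝ) (hε : ∀ n, 0 < ε n) (hε0 : Tendsto ε atTop (nhds 0))
    (u : ℕ → Pl → ℝ) (hu : ∀ n, IsSolution V τ (ε n) (u n))
    (K : Set Pl) (hK : IsCompact K) (hKconn : IsConnected K) (hKZ : K ⊆ (V.Z)ᶜ)
    (hinf : Tendsto (fun n => sInf ((fun x => |u n x|) '' K)) atTop (nhds 0)) :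
    Tendsto (fun n => sSup ((fun x => |u n x|) '' K)) atTop (nhds 0) := by
  obtain ⟨α, hα, hf⟩ := ftau_lower hτ
  have hA : 0 < 1 + (τ ^ 2)⁻¹ := by positivity
  have hf2 : ∀ t : ℝ, |fτ τ t| ≤ (1 + (τ ^ 2)⁻¹) * |t| := fun t => ftau_upper hτ
  obtain ⟨r', hr', hthick⟩ := hK.exists_cthickening_subset_open (Z_closed V).isOpen_compl hKZ
  set r₀ : ℝ := min (r' / 2) (1 / 4) with hr₀
  have hr0 : 0 < r₀ := lt_min (by linarith) (by norm_num)
  have hball : ∀ a ∈ K, closedBall a (2 * r₀) ⊆ (V.Z)ᶜ := by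
    intro a ha
    have h1 : 2 * r₀ ≤ r' := by
      have := min_le_left (r' / 2) (1 / 4 : ℝ)
      linarith
    exact (closedBall_subset_closedBall h1).trans
      ((closedBall_subset_cthickening ha r').trans hthick)
  obtain ⟨x₀, hx₀⟩ := hKconn.nonempty
  rw [Metric.tendsto_nhds]
  intro e he
  set δ : ℝ := min (e / 2) 1 with hδdef
  have hδ : 0 < δ := lt_min (by linarith) one_pos
  have hδ1 : δ ≤ 1 := min_le_right _ _
  have hδe : δ < e := lt_of_le_of_lt (min_le_left _ _) (by linarith)
  have hκ := kap_pos hτ hδ hδ1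
  have hM := M1_nonneg V
  set k₁ : ℝ := M1 V / kap τ δ + 1 with hk₁
  have hk1 : 0 < k₁ := by positivity
  have hk : M1 V / 2 < kap τ δ * k₁ := by
    rw [hk₁, mul_add, mul_div_cancel₀ _ hκ.ne']
    linarith
  set R : ℝ := Real.sqrt (32 / α) with hR
  have hR0 : 0 < R := Real.sqrt_pos.2 (by positivity)
  have hRα : 32 ≤ α * R ^ 2 := by
    rw [hR, Real.sq_sqrt (by positivity), mul_div_cancel₀ _ hα.ne']
  set E : ℝ := Real.exp (-(Real.sqrt (1 + (τ ^ 2)⁻¹) * (R + k₁ + k₁))) with hE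
  have hE0 : 0 < E := Real.exp_pos _
  have hE1 : E ≤ 1 := Real.exp_le_one_iff.2 (by
    have : 0 ≤ Real.sqrt (1 + (τ ^ 2)⁻¹) * (R + k₁ + k₁) := by positivity
    linarith)
  set η : ℝ := δ / 4 * E with hη
  have hη0 : 0 < η := by positivity
  have hηδ : η < δ := by nlinarith
  have ev1 : ∀ᶠ n in atTop, (R + k₁ + k₁) * ε n < r₀ := by
    have := hε0.const_mul (R + k₁ + k₁)
    rw [mul_zero] at this
    exact this.eventually_lt_const hr0
  have ev2 : ∀ᶠ n in atTop, 4 * δ * ε n ^ 2 / (α * r₀ ^ 2) < η := by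
    have := ((hε0.pow 2).const_mul (4 * δ)).div_const (α * r₀ ^ 2)
    rw [show 4 * δ * (0:ℝ) ^ 2 / (α * r₀ ^ 2) = 0 by simp] at this
    exact this.eventually_lt_const hη0
  have ev3 := hinf.eventually_lt_const hη0
  filter_upwards [ev1, ev2, ev3] with n h1 h2 h3
  have hcont : ContinuousOn (fun x => |u n x|) K := ((hu n).smooth.continuousOn.mono hKZ).abs
  have hnn : 0 ≤ sSup ((fun x => |u n x|) '' K) := by
    apply Real.sSup_nonneg
    rintro _ ⟨x, _, rfl⟩
    exact abs_nonneg _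
  have hle : sSup ((fun x => |u n x|) '' K) ≤ δ := by
    apply csSup_le ⟨_, mem_image_of_mem _ hx₀⟩
    rintro _ ⟨x, hx, rfl⟩
    by_contra hc
    push Not at hc
    obtain ⟨_, ⟨y, hy, rfl⟩, hy2⟩ := exists_lt_of_csInf_lt ⟨_, mem_image_of_mem _ hx₀⟩ h3
    obtain ⟨a, haK, ha⟩ := hKconn.isPreconnected.intermediate_value hy hx hcont
      (show η ∈ Icc (|u n y|) (|u n x|) from ⟨hy2.le, (hηδ.trans hc).le⟩)
    change |u n a| = η at ha
    refine core hτ (hε n) (hu n) hδ hδ1 hα hf hA hf2 hR0 hRα hk1 hk h1.le (min_le_right _ _)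
      (hball a haK) ?_ (by rw [ha]; exact h2)
    rw [ha, hη]
    nlinarith [mul_pos hδ hE0]
  rw [Real.dist_eq, sub_zero, abs_of_nonneg hnn]
  linarith
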